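/- arXiv:math/0511307 — 7 statements merged into one kernel-verified Lean document; each statement's English description precedes it below -/
import Mathlib

section
/- Let v_1,…,v_q ∈ ℕ^n be nonzero vectors and let ℝ_+𝒜′ ⊆ ℝ^{n+1} be the Rees cone generated by 𝒜′ = {e_1,…,e_n, (v_1,1),…,(v_q,1)}. For 1 ≤ i ≤ n+1, the set F = ℝ_+𝒜′ ∩ H_{e_i} is a facet of ℝ_+𝒜′ (that is, F = ℝ_+𝒜′ ∩ H_a for a hyperplane H_a with ℝ_+𝒜′ ⊆ H_a^+ and dim F = n) if and only if either i = n+1, or 1 ≤ i ≤ n and ⟨e_i, v_j⟩ = 0 for some j ∈ {1,…,q}. -/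
open Finset

/-- The Rees cone `ℝ₊𝒜′ ⊆ ℝ^{n+1}`: the set of all nonnegative real linear combinations of
`𝒜′ = {e₁, …, eₙ, (v₁,1), …, (v_q,1)}`. -/
def reesCone {n q : ℕ} (v : Fin q → Fin n → ℝ) : Set (Fin (n + 1) → ℝ) :=
  {x | ∃ (a : Fin n → ℝ) (b : Fin q → ℝ), (∀ i, 0 ≤ a i) ∧ (∀ j, 0 ≤ b j) ∧
    x = (∑ i, a i • (Pi.single (Fin.castSucc i) 1 : Fin (n + 1) → ℝ)) +
        ∑ j, b j • (Fin.snoc (v j) 1 : Fin (n + 1) → ℝ)}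

/-- `F` is a facet of `C` of dimension `d`: `F = C ∩ H_a` for some hyperplane `H_a` through the
origin such that `C ⊆ H_a⁺`, and `dim F = d`. -/
def IsFacetOf {m : ℕ} (C F : Set (Fin m → ℝ)) (d : ℕ) : Prop :=
  ∃ a : Fin m → ℝ, a ≠ 0 ∧ F = C ∩ {x | ∑ k, x k * a k = 0} ∧
    (∀ x ∈ C, 0 ≤ ∑ k, x k * a k) ∧
    Module.finrank ℝ (Submodule.span ℝ F) = d

theorem mem_rees_iff {n q : ℕ} (v : Fin q → Fin n → ℝ) (x : Fin (n + 1) → ℝ) :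
    x ∈ reesCone v ↔ ∃ (a : Fin n → ℝ) (b : Fin q → ℝ), (∀ i, 0 ≤ a i) ∧ (∀ j, 0 ≤ b j) ∧
      (∀ k : Fin n, x k.castSucc = a k + ∑ j, b j * v j k) ∧ x (Fin.last n) = ∑ j, b j := by
  unfold reesCone
  simp only [Set.mem_setOf_eq]
  refine exists_congr fun a => exists_congr fun b => and_congr_right fun _ =>
    and_congr_right fun _ => ?_
  rw [funext_iff, Fin.forall_fin_succ']
  refine and_congr (forall_congr' fun k => ?_) ?_
  · simp [Finset.sum_apply, Pi.single_apply]
  · simp [Finset.sum_apply, Pi.single_apply, (Fin.castSucc_lt_last _).ne']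

theorem rees_nonneg {n q : ℕ} (v : Fin q → Fin n → ℕ) (x : Fin (n + 1) → ℝ)
    (hx : x ∈ reesCone fun j l => (v j l : ℝ)) (i : Fin (n + 1)) : 0 ≤ x i := by
  obtain ⟨a, b, ha, hb, h1, h2⟩ := (mem_rees_iff _ _).1 hx
  refine Fin.lastCases ?_ (fun k => ?_) i
  · rw [h2]; exact Finset.sum_nonneg fun j _ => hb j
  · rw [h1]
    exact add_nonneg (ha k) (Finset.sum_nonneg fun j _ => mul_nonneg (hb j) (Nat.cast_nonneg _))

theorem single_mem_rees {n q : ℕ} (v : Fin q → Fin n → ℝ) (k : Fin n) :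
    (Pi.single k.castSucc 1 : Fin (n + 1) → ℝ) ∈ reesCone v := by
  refine (mem_rees_iff _ _).2 ⟨Pi.single k 1, 0, ?_, by simp, ?_, ?_⟩
  · intro i; by_cases h : i = k <;> simp [Pi.single_apply, h]
  · intro i; simp [Pi.single_apply]
  · simp [Pi.single_apply, (Fin.castSucc_lt_last _).ne']

theorem snoc_mem_rees {n q : ℕ} (v : Fin q → Fin n → ℝ) (j : Fin q) :
    (Fin.snoc (v j) 1 : Fin (n + 1) → ℝ) ∈ reesCone v := by
  refine (mem_rees_iff _ _).2 ⟨0, Pi.single j 1, by simp, ?_, ?_, ?_⟩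
  · intro i; by_cases h : i = j <;> simp [Pi.single_apply, h]
  · intro i; simp [Pi.single_apply]
  · simp [Pi.single_apply]

theorem finrank_ker_proj_aux {n : ℕ} (i : Fin (n + 1)) :
    Module.finrank ℝ (LinearMap.ker (LinearMap.proj i : (Fin (n + 1) → ℝ) →ₗ[ℝ] ℝ)) = n := by
  have h := LinearMap.finrank_range_add_finrank_ker
    (LinearMap.proj i : (Fin (n + 1) → ℝ) →ₗ[ℝ] ℝ)
  rw [LinearMap.range_eq_top.2 (LinearMap.proj_surjective i)] at h
  simp at h
  omega

theorem facet_of_ker_le {n q : ℕ} (v : Fin q → Fin n → ℕ) (i : Fin (n + 1))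
    (H : LinearMap.ker (LinearMap.proj i : (Fin (n + 1) → ℝ) →ₗ[ℝ] ℝ) ≤
      Submodule.span ℝ ((reesCone fun j l => (v j l : ℝ)) ∩ {x | x i = 0})) :
    IsFacetOf (reesCone fun j l => (v j l : ℝ))
      ((reesCone fun j l => (v j l : ℝ)) ∩ {x | x i = 0}) n := by
  refine ⟨Pi.single i 1, ?_, ?_, ?_, ?_⟩
  · intro h; simpa using congrFun h i
  · simp [Pi.single_apply]
  · intro x hx; simpa [Pi.single_apply] using rees_nonneg v x hx i
  · have e : Submodule.span ℝ ((reesCone fun j l => (v j l : ℝ)) ∩ {x | x i = 0}) =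
        LinearMap.ker (LinearMap.proj i : (Fin (n + 1) → ℝ) →ₗ[ℝ] ℝ) := by
      refine le_antisymm (Submodule.span_le.2 ?_) H
      rintro x ⟨_, hx⟩
      simpa using hx
    rw [e, finrank_ker_proj_aux]

/-- For nonzero `v₁, …, v_q ∈ ℕⁿ` and `1 ≤ i ≤ n+1`, the set `F = ℝ₊𝒜′ ∩ H_{e_i}` is a facet of
the Rees cone `ℝ₊𝒜′` if and only if either `i = n+1`, or `1 ≤ i ≤ n` and `⟨e_i, v_j⟩ = 0` for
some `j`. -/
theorem stmt1 {n q : ℕ} (v : Fin q → Fin n → ℕ) (hcol : ∀ j, v j ≠ 0) (i : Fin (n + 1)) :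
    IsFacetOf (reesCone fun j l => (v j l : ℝ))
      ((reesCone fun j l => (v j l : ℝ)) ∩ {x | x i = 0}) n ↔
      (i = Fin.last n ∨ ∃ j, (Fin.snoc (v j) 1 : Fin (n + 1) → ℕ) i = 0) := by
  constructor
  · rintro ⟨_, _, _, _, hd⟩
    by_contra hc
    push Not at hc
    obtain ⟨hi, hj⟩ := hc
    obtain ⟨l, rfl⟩ := Fin.exists_castSucc_eq.2 hi
    simp only [Fin.snoc_castSucc] at hj
    have key : ∀ x ∈ ((reesCone fun j l => (v j l : ℝ)) ∩ {x | x l.castSucc = 0}),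
        x (Fin.last n) = 0 := by
      rintro x ⟨hx, hx0⟩
      obtain ⟨a, b, ha, hb, h1, h2⟩ := (mem_rees_iff _ _).1 hx
      have h0 : a l + ∑ j, b j * (v j l : ℝ) = 0 := by rw [← h1]; exact hx0
      have hnn : ∀ j ∈ Finset.univ, 0 ≤ b j * (v j l : ℝ) :=
        fun j _ => mul_nonneg (hb j) (Nat.cast_nonneg _)
      have hs : ∑ j, b j * (v j l : ℝ) = 0 :=
        le_antisymm (by linarith [ha l]) (Finset.sum_nonneg hnn)
      rw [h2]
      refine Finset.sum_eq_zero fun j hju => ?_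
      have := (Finset.sum_eq_zero_iff_of_nonneg hnn).1 hs j hju
      rcases mul_eq_zero.1 this with h | h
      · exact h
      · exact absurd (by exact_mod_cast h) (hj j)
    have hle : Submodule.span ℝ ((reesCone fun j l => (v j l : ℝ)) ∩ {x | x l.castSucc = 0}) <
        LinearMap.ker (LinearMap.proj (Fin.last n) : (Fin (n + 1) → ℝ) →ₗ[ℝ] ℝ) := by
      refine lt_of_le_of_ne (Submodule.span_le.2 fun x hx => by simpa using key x hx) ?_
      intro e
      have hm : (Pi.single l.castSucc 1 : Fin (n + 1) → ℝ) ∈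
          LinearMap.ker (LinearMap.proj (Fin.last n) : (Fin (n + 1) → ℝ) →ₗ[ℝ] ℝ) := by
        simp [Pi.single_apply, (Fin.castSucc_lt_last _).ne']
      rw [← e] at hm
      have hle2 : Submodule.span ℝ
          ((reesCone fun j l => (v j l : ℝ)) ∩ {x | x l.castSucc = 0}) ≤
          LinearMap.ker (LinearMap.proj l.castSucc : (Fin (n + 1) → ℝ) →ₗ[ℝ] ℝ) :=
        Submodule.span_le.2 fun x hx => by simpa using hx.2
      have := hle2 hm
      simp at this
    have := Submodule.finrank_lt_finrank_of_lt hle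
    rw [hd, finrank_ker_proj_aux] at this
    exact lt_irrefl _ this
  · intro h
    apply facet_of_ker_le
    intro x hx
    have hxi : x i = 0 := by simpa using hx
    by_cases hi : i = Fin.last n
    · subst hi
      have e : x = ∑ k : Fin n, x k.castSucc • (Pi.single k.castSucc 1 : Fin (n + 1) → ℝ) := by
        rw [funext_iff, Fin.forall_fin_succ']
        refine ⟨fun k => ?_, ?_⟩
        · simp [Finset.sum_apply, Pi.single_apply]
        · simp [Finset.sum_apply, Pi.single_apply, (Fin.castSucc_lt_last _).ne', hxi]
      rw [e]
      refine Submodule.sum_mem _ fun k _ => Submodule.smul_mem _ _ (Submodule.subset_span ?_)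
      exact ⟨single_mem_rees _ k, by simp [Pi.single_apply, (Fin.castSucc_lt_last _).ne']⟩
    · obtain ⟨j, hj⟩ := h.resolve_left hi
      obtain ⟨l, rfl⟩ := Fin.exists_castSucc_eq.2 hi
      rw [Fin.snoc_castSucc] at hj
      have e : x = x (Fin.last n) • (Fin.snoc (fun k => (v j k : ℝ)) 1 : Fin (n + 1) → ℝ) +
          ∑ k : Fin n, (x k.castSucc - x (Fin.last n) * v j k) •
            (Pi.single k.castSucc 1 : Fin (n + 1) → ℝ) := by
        rw [funext_iff, Fin.forall_fin_succ']
        refine ⟨fun k => ?_, ?_⟩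
        · simp [Finset.sum_apply, Pi.single_apply]
        · simp [Finset.sum_apply, Pi.single_apply, (Fin.castSucc_lt_last _).ne']
      rw [e]
      refine Submodule.add_mem _ (Submodule.smul_mem _ _ (Submodule.subset_span ?_))
        (Submodule.sum_mem _ fun k _ => ?_)
      · exact ⟨snoc_mem_rees (fun j l => (v j l : ℝ)) j, by simp [hj]⟩
      · by_cases hk : k = l
        · subst hk
          simp [hxi, hj]
        · refine Submodule.smul_mem _ _ (Submodule.subset_span ?_)
          exact ⟨single_mem_rees _ k, by simp [Pi.single_apply, Ne.symm hk]⟩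
end

section
/- Let v_1,…,v_q ∈ ℕ^n be nonzero vectors, let 𝒥 = {i : 1 ≤ i ≤ n and ⟨e_i, v_j⟩ = 0 for some j} ∪ {n+1}, let V be the set of vertices of the set covering polyhedron Q(A), and set ℬ = {e_i : i ∈ 𝒥} ∪ {(α,−1) : α ∈ V} ⊆ ℝ^{n+1}. Then no vector β ∈ ℬ lies in the cone generated by ℬ∖{β}; consequently the representation ℝ_+𝒜′ = (⋂_{i ∈ 𝒥} H_{e_i}^+) ∩ (⋂_{α ∈ V} H_{(α,−1)}^+) is irreducible, i.e., none of the closed half-spaces can be omitted from the intersection. -/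
open Finset

/-- The set covering polyhedron `Q(A) = {x ∈ ℝⁿ | x ≥ 0, xA ≥ 1}`. -/
def coveringPolyhedron {n q : ℕ} (v : Fin q → Fin n → ℝ) : Set (Fin n → ℝ) :=
  {x | (∀ i, 0 ≤ x i) ∧ ∀ j, 1 ≤ ∑ i, x i * v j i}

/-- The cone `ℝ₊S` generated by a set `S`: all finite nonnegative real linear combinations of
elements of `S`. -/
def coneGen {m : ℕ} (S : Set (Fin m → ℝ)) : Set (Fin m → ℝ) :=
  {x | ∃ (r : ℕ) (c : Fin r → ℝ) (u : Fin r → Fin m → ℝ),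
    (∀ l, 0 ≤ c l) ∧ (∀ l, u l ∈ S) ∧ x = ∑ l, c l • u l}

/-- The set `ℬ = {e_i | i ∈ 𝒥} ∪ {(α,-1) | α ∈ V}`, where
`𝒥 = {i ≤ n | ⟨e_i, v_j⟩ = 0 for some j} ∪ {n+1}` and `V` is the vertex set of `Q(A)`. -/
def dualBasisSet {n q : ℕ} (v : Fin q → Fin n → ℕ) : Set (Fin (n + 1) → ℝ) :=
  {y | (∃ i : Fin (n + 1),
          (i = Fin.last n ∨ ∃ j, (Fin.snoc (v j) 1 : Fin (n + 1) → ℕ) i = 0) ∧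
          y = (Pi.single i 1 : Fin (n + 1) → ℝ)) ∨
       (∃ α ∈ Set.extremePoints ℝ (coveringPolyhedron fun j l => (v j l : ℝ)),
          y = (Fin.snoc α (-1) : Fin (n + 1) → ℝ))}


lemma aux_ev (a b : ℝ) (ha : 0 ≤ a) (hb : a = 0 → b = 0) :
    ∀ᶠ ε in nhdsWithin (0 : ℝ) (Set.Ioi 0), 0 ≤ a + ε * b ∧ 0 ≤ a - ε * b := by
  rcases ha.eq_or_lt with h | h
  · have := hb h.symm
    subst this
    simp [ha]
  · apply Filter.Eventually.filter_mono nhdsWithin_le_nhds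
    have h1 : ContinuousAt (fun ε : ℝ => a + ε * b) 0 := by fun_prop
    have h2 : ContinuousAt (fun ε : ℝ => a - ε * b) 0 := by fun_prop
    have e1 := h1.eventually (lt_mem_nhds (a := 0) (by simpa using h))
    have e2 := h2.eventually (lt_mem_nhds (a := 0) (by simpa using h))
    filter_upwards [e1, e2] with ε x y
    exact ⟨x.le, y.le⟩

lemma aux_ext {n q : ℕ} (v : Fin q → Fin n → ℝ) (α : Fin n → ℝ)
    (h : α ∈ Set.extremePoints ℝ (coveringPolyhedron v)) (d : Fin n → ℝ)
    (h1 : ∀ i, α i = 0 → d i = 0)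
    (h2 : ∀ j, ∑ i, α i * v j i = 1 → ∑ i, d i * v j i = 0) : d = 0 := by
  rw [mem_extremePoints_iff_left] at h
  obtain ⟨⟨ha, hb⟩, hex⟩ := h
  have E1 : ∀ᶠ ε in nhdsWithin (0 : ℝ) (Set.Ioi 0),
      ∀ i, 0 ≤ α i + ε * d i ∧ 0 ≤ α i - ε * d i :=
    Filter.eventually_all.2 fun i => aux_ev _ _ (ha i) (h1 i)
  have E2 : ∀ᶠ ε in nhdsWithin (0 : ℝ) (Set.Ioi 0),
      ∀ j, 0 ≤ (∑ i, α i * v j i - 1) + ε * ∑ i, d i * v j i ∧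
        0 ≤ (∑ i, α i * v j i - 1) - ε * ∑ i, d i * v j i :=
    Filter.eventually_all.2 fun j => aux_ev _ _ (by linarith [hb j])
      (fun h => h2 j (by linarith))
  obtain ⟨ε, ⟨e1, e2⟩, e3⟩ := ((E1.and E2).and self_mem_nhdsWithin).exists
  have e3 : 0 < ε := e3
  have := hex (α + ε • d) ⟨fun i => by simpa using (e1 i).1, fun j => by
      have := (e2 j).1
      simp only [Pi.add_apply, Pi.smul_apply, smul_eq_mul, add_mul, Finset.sum_add_distrib,
        mul_assoc, ← Finset.mul_sum]
      linarith⟩ (α - ε • d) ⟨fun i => by simpa using (e1 i).2, fun j => by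
      have := (e2 j).2
      simp only [Pi.sub_apply, Pi.smul_apply, smul_eq_mul, sub_mul, Finset.sum_sub_distrib,
        mul_assoc, ← Finset.mul_sum]
      linarith⟩ ⟨1/2, 1/2, by norm_num, by norm_num, by norm_num, by
        ext i; simp; ring⟩
  have h3 : ε • d = 0 := by simpa using this
  exact (smul_eq_zero.1 h3).resolve_left e3.ne'

/-- tight constraints -/
def tightSet {n q : ℕ} (v : Fin q → Fin n → ℝ) (α : Fin n → ℝ) : Set (Fin n ⊕ Fin q) :=
  {k | Sum.elim (fun i => α i = 0) (fun j => ∑ i, α i * v j i = 1) k}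

lemma aux_tight {n q : ℕ} (v : Fin q → Fin n → ℝ) (α α' : Fin n → ℝ)
    (h : α ∈ Set.extremePoints ℝ (coveringPolyhedron v))
    (h1 : ∀ i, α i = 0 → α' i = 0)
    (h2 : ∀ j, ∑ i, α i * v j i = 1 → ∑ i, α' i * v j i = 1) : α' = α := by
  have := aux_ext v α h (α' - α) (fun i hi => by simp [hi, h1 i hi]) (fun j hj => by
    simp only [Pi.sub_apply, sub_mul, Finset.sum_sub_distrib, hj, h2 j hj, sub_self])
  exact sub_eq_zero.1 this

lemma aux_fin {n q : ℕ} (v : Fin q → Fin n → ℝ) :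
    (Set.extremePoints ℝ (coveringPolyhedron v)).Finite := by
  apply Set.Finite.of_finite_image (f := tightSet v) (Set.toFinite _)
  intro α hα α' _ he
  refine (aux_tight v α α' hα (fun i hi => ?_) (fun j hj => ?_)).symm
  · have : Sum.inl i ∈ tightSet v α := hi
    rw [he] at this
    exact this
  · have : Sum.inr j ∈ tightSet v α := hj
    rw [he] at this
    exact this

lemma aux_le_one {n q : ℕ} (v : Fin q → Fin n → ℕ) (α : Fin n → ℝ)
    (h : α ∈ Set.extremePoints ℝ (coveringPolyhedron fun j l => (v j l : ℝ))) (i : Fin n) :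
    α i ≤ 1 := by
  by_contra! hc
  have hQ := h.1.1
  have := aux_ext _ α h (Pi.single i 1) (fun k hk => by
      have : k ≠ i := by rintro rfl; linarith
      simp [this]) (fun j hj => by
      simp only [Pi.single_apply, ite_mul, one_mul, zero_mul, Finset.sum_ite_eq',
        Finset.mem_univ, if_true]
      by_contra hne
      have h1 : (1 : ℝ) ≤ v j i := by
        have : v j i ≠ 0 := by exact_mod_cast hne
        exact_mod_cast Nat.one_le_iff_ne_zero.2 this
      have h2 : α i * (v j i : ℝ) ≤ ∑ k, α k * (v j k : ℝ) :=
        Finset.single_le_sum (f := fun k => α k * (v j k : ℝ))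
          (fun k _ => mul_nonneg (hQ k) (Nat.cast_nonneg _)) (Finset.mem_univ i)
      nlinarith)
  have := congrFun this i
  simp at this

lemma aux_exposed {n q : ℕ} (v : Fin q → Fin n → ℕ) (α : Fin n → ℝ)
    (h : α ∈ Set.extremePoints ℝ (coveringPolyhedron fun j l => (v j l : ℝ))) :
    ∃ (w : Fin n → ℝ) (s : ℝ), (∀ i, 0 ≤ w i) ∧ 0 ≤ s ∧ ∑ i, w i * α i < s ∧
      ∀ α' ∈ Set.extremePoints ℝ (coveringPolyhedron fun j l => (v j l : ℝ)), α' ≠ α →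
        s ≤ ∑ i, w i * α' i := by
  classical
  set V := Set.extremePoints ℝ (coveringPolyhedron fun j l => (v j l : ℝ)) with hV
  let T : Finset (Fin q) := univ.filter fun j => ∑ i, α i * (v j i : ℝ) = 1
  let w : Fin n → ℝ := fun i => (if α i = 0 then 1 else 0) + ∑ j ∈ T, (v j i : ℝ)
  have hw : ∀ i, 0 ≤ w i := fun i => by
    have : 0 ≤ ∑ j ∈ T, (v j i : ℝ) := Finset.sum_nonneg fun j _ => Nat.cast_nonneg _
    have : (0 : ℝ) ≤ if α i = 0 then 1 else 0 := by split_ifs <;> norm_num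
    simp only [w]; linarith
  have hsum : ∀ x : Fin n → ℝ, ∑ i, w i * x i =
      ∑ i, (if α i = 0 then x i else 0) + ∑ j ∈ T, ∑ i, x i * (v j i : ℝ) := fun x => by
    rw [Finset.sum_comm, ← Finset.sum_add_distrib]
    refine Finset.sum_congr rfl fun i _ => ?_
    simp only [w, add_mul, ite_mul, one_mul, zero_mul, ← Finset.mul_sum]
    ring
  have hα : ∑ i, w i * α i = T.card := by
    rw [hsum]
    have h1 : ∑ i, (if α i = 0 then α i else 0) = 0 :=
      Finset.sum_eq_zero fun i _ => by split_ifs with h <;> simp [h]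
    have h2 : ∑ j ∈ T, ∑ i, α i * (v j i : ℝ) = ∑ j ∈ T, 1 :=
      Finset.sum_congr rfl fun j hj => (Finset.mem_filter.1 hj).2
    rw [h1, h2]; simp
  have hlt : ∀ α' ∈ V, α' ≠ α → (T.card : ℝ) < ∑ i, w i * α' i := by
    intro α' h' hne
    by_contra! hc
    apply hne
    rw [hsum] at hc
    have p1 : ∀ i ∈ (univ : Finset (Fin n)), 0 ≤ (if α i = 0 then α' i else 0) := fun i _ => by
      split_ifs
      · exact h'.1.1 i
      · exact le_rfl
    have p2 : ∀ j ∈ T, 0 ≤ ∑ i, α' i * (v j i : ℝ) - 1 := fun j _ => by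
      have := h'.1.2 j
      simp only at this
      linarith
    have s1 := Finset.sum_nonneg p1
    have s2 := Finset.sum_nonneg p2
    have s3 : ∑ j ∈ T, (∑ i, α' i * (v j i : ℝ) - 1) =
        ∑ j ∈ T, ∑ i, α' i * (v j i : ℝ) - T.card := by
      rw [Finset.sum_sub_distrib]; simp
    have z1 := (Finset.sum_eq_zero_iff_of_nonneg p1).1 (by linarith)
    have z2 := (Finset.sum_eq_zero_iff_of_nonneg p2).1 (by linarith)
    refine aux_tight _ α α' h (fun i hi => ?_) (fun j hj => ?_)
    · simpa [hi] using z1 i (Finset.mem_univ i)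
    · have := z2 j (by simp [T, hj])
      linarith
  have hev : ∀ᶠ s in nhdsWithin (T.card : ℝ) (Set.Ioi (T.card : ℝ)),
      ∀ α' ∈ V, α' ≠ α → s ≤ ∑ i, w i * α' i := by
    apply Filter.Eventually.filter_mono nhdsWithin_le_nhds
    rw [(aux_fin (fun j l => (v j l : ℝ))).eventually_all]
    intro α' h'
    by_cases hne : α' = α
    · simp [hne]
    · filter_upwards [gt_mem_nhds (hlt α' h' hne)] with s hs _
      exact hs.le
  obtain ⟨s, hs, hs'⟩ := (hev.and self_mem_nhdsWithin).exists
  have hs' : (T.card : ℝ) < s := hs'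
  exact ⟨w, s, hw, (lt_of_le_of_lt (Nat.cast_nonneg _) hs').le, by rw [hα]; exact hs', hs⟩

lemma aux_sep {n q : ℕ} (v : Fin q → Fin n → ℕ) (β : Fin (n + 1) → ℝ)
    (hβ : β ∈ dualBasisSet v) :
    ∃ x : Fin (n + 1) → ℝ, (∀ b ∈ dualBasisSet v \ {β}, 0 ≤ ∑ k, x k * b k) ∧
      ∑ k, x k * β k < 0 := by
  rcases hβ with ⟨i, hi, rfl⟩ | ⟨α, hα, rfl⟩
  · induction i using Fin.lastCases with
    | last =>
      refine ⟨Pi.single (Fin.last n) (-1), ?_, by simp [Pi.single_apply]⟩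
      rintro b ⟨⟨k, hk, rfl⟩ | ⟨α, hα, rfl⟩, hb⟩
      · have : k ≠ Fin.last n := by rintro rfl; exact hb rfl
        simp [Pi.single_apply, this]
      · simp [Fin.sum_univ_castSucc, Pi.single_apply]
    | cast i =>
      obtain ⟨j, hj⟩ := hi.resolve_left (Fin.castSucc_lt_last i).ne
      rw [Fin.snoc_castSucc] at hj
      refine ⟨Fin.snoc (fun k => 2 * (v j k : ℝ) - if k = i then 1 else 0) 1, ?_, ?_⟩
      · rintro b ⟨⟨k, hk, rfl⟩ | ⟨α, hα, rfl⟩, hb⟩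
        · have hk : k ≠ Fin.castSucc i := by rintro rfl; exact hb rfl
          simp only [Pi.single_apply, mul_ite, mul_one, mul_zero, Finset.sum_ite_eq',
            Finset.mem_univ, if_true]
          induction k using Fin.lastCases with
          | last => simp
          | cast k =>
            have : k ≠ i := by rintro rfl; exact hk rfl
            simp [this]
        · have h1 := aux_le_one v α hα i
          have h2 := hα.1.2 j
          have h3 : ∑ k, (2 * (v j k : ℝ) - if k = i then 1 else 0) * α k =
              2 * ∑ k, α k * (v j k : ℝ) - α i := by
            simp only [sub_mul, Finset.sum_sub_distrib, Finset.mul_sum, ite_mul, one_mul,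
              zero_mul, Finset.sum_ite_eq', Finset.mem_univ, if_true]
            congr 1
            exact Finset.sum_congr rfl fun k _ => by ring
          simp only [Fin.sum_univ_castSucc, Fin.snoc_castSucc, Fin.snoc_last]
          rw [h3]
          simp only at h2
          linarith
      · simp [Pi.single_apply, hj]
  · obtain ⟨w, s, hw, hs, hlt, hge⟩ := aux_exposed v α hα
    refine ⟨Fin.snoc w s, ?_, ?_⟩
    · rintro b ⟨⟨k, hk, rfl⟩ | ⟨α', hα', rfl⟩, hb⟩
      · simp only [Pi.single_apply, mul_ite, mul_one, mul_zero, Finset.sum_ite_eq',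
            Finset.mem_univ, if_true]
        induction k using Fin.lastCases with
        | last => simpa using hs
        | cast k => simpa using hw k
      · have := hge α' hα' (by rintro rfl; exact hb rfl)
        simp only [Fin.sum_univ_castSucc, Fin.snoc_castSucc, Fin.snoc_last]
        linarith
    · simp only [Fin.sum_univ_castSucc, Fin.snoc_castSucc, Fin.snoc_last]
      linarith

lemma aux_rees {n q : ℕ} (v : Fin q → Fin n → ℕ) (β : Fin (n + 1) → ℝ)
    (hβ : β ∈ dualBasisSet v) (x : Fin (n + 1) → ℝ)
    (hx : x ∈ reesCone fun j l => (v j l : ℝ)) : 0 ≤ ∑ k, x k * β k := by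
  obtain ⟨a, b, ha, hb, rfl⟩ := hx
  have c1 : ∀ i : Fin n, 0 ≤ β (Fin.castSucc i) := by
    intro i
    rcases hβ with ⟨k, _, rfl⟩ | ⟨α, hα, rfl⟩
    · simp only [Pi.single_apply]; split_ifs <;> norm_num
    · simpa using hα.1.1 i
  have c2 : ∀ j, 0 ≤ ∑ k, (Fin.snoc (fun l => (v j l : ℝ)) 1 : Fin (n + 1) → ℝ) k * β k := by
    intro j
    rcases hβ with ⟨k, _, rfl⟩ | ⟨α, hα, rfl⟩
    · simp only [Pi.single_apply, mul_ite, mul_one, mul_zero, Finset.sum_ite_eq',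
            Finset.mem_univ, if_true]
      induction k using Fin.lastCases with
      | last => simp
      | cast k => simp
    · have := hα.1.2 j
      simp only [mul_comm (α _)] at this
      simp only [Fin.sum_univ_castSucc, Fin.snoc_castSucc, Fin.snoc_last]
      linarith
  change 0 ≤ (_ : Fin (n+1) → ℝ) ⬝ᵥ β
  rw [add_dotProduct, sum_dotProduct, sum_dotProduct]
  refine add_nonneg (Finset.sum_nonneg fun i _ => ?_) (Finset.sum_nonneg fun j _ => ?_)
  · rw [smul_dotProduct, single_dotProduct, one_mul]
    exact mul_nonneg (ha i) (c1 i)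
  · rw [smul_dotProduct]
    exact mul_nonneg (hb j) (c2 j)

/-- No vector `β ∈ ℬ` lies in the cone generated by `ℬ \ {β}`; consequently the representation
`ℝ₊𝒜′ = (⋂_{i ∈ 𝒥} H⁺_{e_i}) ∩ (⋂_{α ∈ V} H⁺_{(α,-1)})` is irreducible: none of the closed
half-spaces `H_b⁺`, `b ∈ ℬ`, can be omitted from the intersection. -/
theorem stmt3 {n q : ℕ} (v : Fin q → Fin n → ℕ) (hcol : ∀ j, v j ≠ 0) :
    (∀ β ∈ dualBasisSet v, β ∉ coneGen (dualBasisSet v \ {β})) ∧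
    (∀ β ∈ dualBasisSet v,
      {x | ∀ b ∈ dualBasisSet v \ {β}, 0 ≤ ∑ k, x k * b k} ≠
        (reesCone fun j l => (v j l : ℝ))) := by
  refine ⟨fun β hβ hc => ?_, fun β hβ he => ?_⟩
  · obtain ⟨x, h1, h2⟩ := aux_sep v β hβ
    obtain ⟨r, c, u, hc, hu, hs⟩ := hc
    have : 0 ≤ x ⬝ᵥ β := by
      rw [hs, dotProduct_sum]
      refine Finset.sum_nonneg fun l _ => ?_
      rw [dotProduct_smul]
      exact mul_nonneg (hc l) (h1 _ (hu l))
    exact absurd h2 (not_lt.2 this)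
  · obtain ⟨x, h1, h2⟩ := aux_sep v β hβ
    have hx : x ∈ reesCone fun j l => (v j l : ℝ) := by
      rw [← he]; exact h1
    exact absurd h2 (not_lt.2 (aux_rees v β hβ x hx))
end

section
/- Let 𝒞 be a clutter with incidence matrix A having columns v_1,…,v_q ∈ {0,1}^n. Then 𝒞 has the max-flow min-cut property if and only if the set covering polyhedron Q(A) is an integral polyhedron (all its vertices have integer coordinates) and the affine semigroup ℕ𝒜′ generated by 𝒜′ = {e_1,…,e_n,(v_1,1),…,(v_q,1)} satisfies ℕ𝒜′ = ℤ^{n+1} ∩ ℝ_+𝒜′ (equivalently, the Rees algebra R[It] of the edge ideal I of 𝒞 is a normal domain). -/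
open Finset

/-- The family `E` of edges (indexed by `Fin q`) is a clutter on the vertex set `Fin n`:
edges are nonempty and none of them is included in another. -/
def IsClutter {n q : ℕ} (E : Fin q → Finset (Fin n)) : Prop :=
  (∀ j, (E j).Nonempty) ∧ ∀ j j' : Fin q, E j ⊆ E j' → j = j'

/-- The columns `v₁, …, v_q ∈ {0,1}ⁿ` of the incidence matrix of the clutter with edges `E`:
the characteristic vectors of the edges. -/
def incidence {n q : ℕ} (E : Fin q → Finset (Fin n)) : Fin q → Fin n → ℝ :=
  fun j i => if i ∈ E j then 1 else 0

/-- A vector is integral if all its entries are integers. -/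
def IsIntegralVec {m : ℕ} (x : Fin m → ℝ) : Prop := ∀ i, ∃ z : ℤ, x i = z

/-- `Q(A)` is an integral polyhedron: all its vertices (extreme points) have integer
coordinates. -/
def IntegralPolyhedron {n q : ℕ} (v : Fin q → Fin n → ℝ) : Prop :=
  ∀ x ∈ Set.extremePoints ℝ (coveringPolyhedron v), IsIntegralVec x

/-- The clutter with edges `E` has the max-flow min-cut property: for every `α ∈ ℕⁿ`, both the
linear program `min {⟨α,x⟩ | x ≥ 0, xA ≥ 1}` and its dual `max {⟨y,1⟩ | y ≥ 0, Ay ≤ α}` have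
integral optimal solutions. -/
def HasMFMC {n q : ℕ} (E : Fin q → Finset (Fin n)) : Prop :=
  ∀ α : Fin n → ℕ,
    (∃ x : Fin n → ℝ, IsIntegralVec x ∧ (∀ i, 0 ≤ x i) ∧
      (∀ j, 1 ≤ ∑ i, x i * incidence E j i) ∧
      ∀ x' : Fin n → ℝ, (∀ i, 0 ≤ x' i) → (∀ j, 1 ≤ ∑ i, x' i * incidence E j i) →
        ∑ i, (α i : ℝ) * x i ≤ ∑ i, (α i : ℝ) * x' i) ∧
    (∃ y : Fin q → ℝ, IsIntegralVec y ∧ (∀ j, 0 ≤ y j) ∧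
      (∀ i, ∑ j, y j * incidence E j i ≤ α i) ∧
      ∀ y' : Fin q → ℝ, (∀ j, 0 ≤ y' j) → (∀ i, ∑ j, y' j * incidence E j i ≤ α i) →
        ∑ j, y' j ≤ ∑ j, y j)

/-- The affine semigroup `ℕ𝒜′ ⊆ ℝ^{n+1}`: all linear combinations of
`𝒜′ = {e₁, …, eₙ, (v₁,1), …, (v_q,1)}` with nonnegative integer coefficients. -/
def reesSemigroup {n q : ℕ} (v : Fin q → Fin n → ℝ) : Set (Fin (n + 1) → ℝ) :=
  {x | ∃ (a : Fin n → ℕ) (b : Fin q → ℕ),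
    x = (∑ i, (a i : ℝ) • (Pi.single (Fin.castSucc i) 1 : Fin (n + 1) → ℝ)) +
        ∑ j, (b j : ℝ) • (Fin.snoc (v j) 1 : Fin (n + 1) → ℝ)}

/-- `ℕ𝒜′ = ℤ^{n+1} ∩ ℝ₊𝒜′`; equivalently, the Rees algebra `R[It]` is a normal domain. -/
def NormalReesAlgebra {n q : ℕ} (v : Fin q → Fin n → ℝ) : Prop :=
  reesSemigroup v = {x ∈ reesCone v | IsIntegralVec x}

theorem decomp_iff {n q : ℕ} (v : Fin q → Fin n → ℝ) (a : Fin n → ℝ) (b : Fin q → ℝ)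
    (x : Fin (n + 1) → ℝ) :
    x = (∑ i, a i • (Pi.single (Fin.castSucc i) 1 : Fin (n + 1) → ℝ)) +
        ∑ j, b j • (Fin.snoc (v j) 1 : Fin (n + 1) → ℝ) ↔
    (∀ i : Fin n, x i.castSucc = a i + ∑ j, b j * v j i) ∧ x (Fin.last n) = ∑ j, b j := by
  rw [funext_iff, Fin.forall_fin_succ']
  have h0 : ∀ i : Fin n, (Fin.last n) ≠ i.castSucc := fun i => (Fin.castSucc_lt_last i).ne'
  simp [Finset.sum_apply, Pi.single_apply, h0]

theorem farkas_aux {n q : ℕ} (E : Fin q → Finset (Fin n)) (hE : ∀ j, (E j).Nonempty)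
    (α : Fin n → ℝ) (hα : ∀ i, 0 ≤ α i) (m : ℝ)
    (hm : ∀ x ∈ coveringPolyhedron (incidence E), m ≤ ∑ i, α i * x i) :
    ∃ b : Fin q → ℝ, (∀ j, 0 ≤ b j) ∧ (∀ i, ∑ j, b j * incidence E j i ≤ α i) ∧
      m ≤ ∑ j, b j := by
  set S : Set ((Fin n → ℝ) × ℝ) := {p | ∃ b : Fin q → ℝ, (∀ j, 0 ≤ b j) ∧
    (∀ i, ∑ j, b j * incidence E j i ≤ p.1 i) ∧ p.2 ≤ ∑ j, b j} with hS
  have hinc : ∀ j i, 0 ≤ incidence E j i := by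
    intro j i; unfold incidence; split_ifs <;> norm_num
  have hconv : Convex ℝ S := by
    rintro p ⟨b, hb0, hb1, hb2⟩ p' ⟨b', hb0', hb1', hb2'⟩ s t hs ht hst
    refine ⟨fun j => s * b j + t * b' j, fun j => ?_, fun i => ?_, ?_⟩
    · have := hb0 j; have := hb0' j; positivity
    · have h1 := mul_le_mul_of_nonneg_left (hb1 i) hs
      have h2 := mul_le_mul_of_nonneg_left (hb1' i) ht
      simp only [add_mul, Finset.sum_add_distrib, mul_assoc, ← Finset.mul_sum, Prod.fst_add,
        Prod.smul_fst, Pi.add_apply, Pi.smul_apply, smul_eq_mul]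
      linarith
    · have h1 := mul_le_mul_of_nonneg_left hb2 hs
      have h2 := mul_le_mul_of_nonneg_left hb2' ht
      simp only [Finset.sum_add_distrib, ← Finset.mul_sum, Prod.snd_add,
        Prod.smul_snd, smul_eq_mul]
      linarith
  have hclosed : IsClosed S := by
    apply IsSeqClosed.isClosed
    intro p l hp hl
    choose b hb0 hb1 hb2 using hp
    choose i0 hi0 using hE
    have hl1 : Filter.Tendsto (fun k => (p k).1) Filter.atTop (nhds l.1) :=
      (continuous_fst.tendsto l).comp hl
    have hl2 : Filter.Tendsto (fun k => (p k).2) Filter.atTop (nhds l.2) :=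
      (continuous_snd.tendsto l).comp hl
    have hl1' : ∀ i, Filter.Tendsto (fun k => (p k).1 i) Filter.atTop (nhds (l.1 i)) :=
      fun i => ((continuous_apply i).tendsto _).comp hl1
    have hM : ∀ i, ∃ M, ∀ k, (p k).1 i ≤ M := by
      intro i
      obtain ⟨M, hM⟩ := (hl1' i).bddAbove_range
      exact ⟨M, fun k => hM ⟨k, rfl⟩⟩
    choose M hM using hM
    have hbox : ∀ k, b k ∈ Set.Icc (0 : Fin q → ℝ) (fun j => M (i0 j)) := by
      intro k
      refine ⟨fun j => hb0 k j, fun j => ?_⟩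
      refine le_trans ?_ ((hb1 k (i0 j)).trans (hM _ k))
      have := Finset.single_le_sum (f := fun j' => b k j' * incidence E j' (i0 j))
        (fun j' _ => mul_nonneg (hb0 k j') (hinc _ _)) (Finset.mem_univ j)
      simpa [incidence, hi0 j] using this
    obtain ⟨c, hc, φ, hφ, hlim⟩ := isCompact_Icc.tendsto_subseq hbox
    have hlim' : ∀ j, Filter.Tendsto (fun k => b (φ k) j) Filter.atTop (nhds (c j)) :=
      fun j => ((continuous_apply j).tendsto _).comp hlim
    refine ⟨c, fun j => hc.1 j, fun i => ?_, ?_⟩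
    · refine le_of_tendsto_of_tendsto' (tendsto_finsetSum _ fun j _ =>
        (hlim' j).mul_const (incidence E j i)) ((hl1' i).comp hφ.tendsto_atTop) ?_
      intro k; exact hb1 (φ k) i
    · refine le_of_tendsto_of_tendsto' (hl2.comp hφ.tendsto_atTop)
        (tendsto_finsetSum _ fun j _ => hlim' j) ?_
      intro k; exact hb2 (φ k)
  by_contra hcon
  have hnot : (α, m) ∉ S := hcon
  obtain ⟨f, u, hfu, hf⟩ := geometric_hahn_banach_point_closed hconv hclosed hnot
  have h0S : (0 : (Fin n → ℝ) × ℝ) ∈ S := ⟨0, by simp, by simp, by simp⟩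
  have hu : u < 0 := by simpa using hf 0 h0S
  have hpos : ∀ s ∈ S, 0 ≤ f s := by
    rintro s ⟨b, hb0, hb1, hb2⟩
    by_contra hneg
    push Not at hneg
    have ht : 0 < u / f s := div_pos_of_neg_of_neg hu hneg
    have hmem : (u / f s) • s ∈ S := by
      refine ⟨fun j => (u / f s) * b j, fun j => mul_nonneg ht.le (hb0 j), fun i => ?_, ?_⟩
      · have h1 := mul_le_mul_of_nonneg_left (hb1 i) ht.le
        simpa only [mul_assoc, ← Finset.mul_sum, Prod.smul_fst, Pi.smul_apply, smul_eq_mul] using h1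
      · have h1 := mul_le_mul_of_nonneg_left hb2 ht.le
        simpa only [← Finset.mul_sum, Prod.smul_snd, smul_eq_mul] using h1
    have := hf _ hmem
    rw [map_smul, smul_eq_mul, div_mul_cancel₀ _ hneg.ne] at this
    exact lt_irrefl _ this
  set x : Fin n → ℝ := fun i => f (Pi.single i 1, 0) with hx
  set lam : ℝ := - f (0, 1) with hlam
  have hfor : ∀ (c : Fin n → ℝ) (t : ℝ), f (c, t) = ∑ i, c i * x i - lam * t := by
    intro c t
    have h1 : ((c, t) : (Fin n → ℝ) × ℝ)
        = (∑ i, c i • ((Pi.single i 1, 0) : (Fin n → ℝ) × ℝ)) + t • ((0, 1) : (Fin n → ℝ) × ℝ) := by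
      ext i
      · simp [Prod.fst_sum, Finset.sum_apply, Pi.single_apply]
      · simp [Prod.snd_sum]
    rw [h1, map_add, map_sum, map_smul]
    simp only [map_smul, smul_eq_mul, hx, hlam]
    ring
  have hx0 : ∀ i, 0 ≤ x i := by
    intro i
    apply hpos
    refine ⟨0, by simp, fun i' => ?_, by simp⟩
    simp only [Pi.zero_apply, zero_mul, Finset.sum_const_zero]
    by_cases h : i' = i
    · subst h; simp
    · simp [h]
  have hlam0 : 0 ≤ lam := by
    have := hpos (0, -1) ⟨0, by simp, by simp, by simp⟩
    rw [hfor] at this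
    simpa using this
  have hcov : ∀ j, lam ≤ ∑ i, x i * incidence E j i := by
    intro j
    have := hpos (incidence E j, 1) ⟨Pi.single j 1, fun j' => by
      by_cases h : j' = j
      · subst h; simp
      · simp [h], by simp [Pi.single_apply], by simp⟩
    rw [hfor] at this
    simp only [mul_comm (x _)]
    linarith
  have hneg : ∑ i, α i * x i - lam * m < 0 := by rw [← hfor]; linarith
  have hsum : 0 ≤ ∑ i, α i * x i := Finset.sum_nonneg fun i _ => mul_nonneg (hα i) (hx0 i)
  rcases hlam0.eq_or_lt with h | h
  · rw [← h] at hneg; linarith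
  · have := hm (fun i => x i / lam) ⟨fun i => div_nonneg (hx0 i) h.le, fun j => by
      simp only [div_mul_eq_mul_div]
      rw [← Finset.sum_div, le_div_iff₀ h]
      simpa using hcov j⟩
    simp only [← mul_div_assoc] at this
    rw [← Finset.sum_div, le_div_iff₀ h] at this
    linarith

theorem exists_min_extreme {n q : ℕ} (E : Fin q → Finset (Fin n)) (hE : ∀ j, (E j).Nonempty)
    (α : Fin n → ℝ) (hα : ∀ i, 0 ≤ α i) :
    ∃ x ∈ Set.extremePoints ℝ (coveringPolyhedron (incidence E)),
      ∀ x' ∈ coveringPolyhedron (incidence E), ∑ i, α i * x i ≤ ∑ i, α i * x' i := by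
  set Q := coveringPolyhedron (incidence E) with hQ
  have hinc : ∀ j i, 0 ≤ incidence E j i := by
    intro j i; unfold incidence; split_ifs <;> norm_num
  have hQc : IsClosed Q := by
    rw [hQ]; unfold coveringPolyhedron
    simp only [Set.ofPred_and, Set.ofPred_forall]
    refine IsClosed.inter (isClosed_iInter fun i => ?_) (isClosed_iInter fun j => ?_)
    · exact isClosed_le continuous_const (continuous_apply i)
    · exact isClosed_le continuous_const (by fun_prop)
  have hone : (fun _ => 1 : Fin n → ℝ) ∈ Q := by
    refine ⟨fun _ => zero_le_one, fun j => ?_⟩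
    obtain ⟨i, hi⟩ := hE j
    have := Finset.single_le_sum (f := fun i => 1 * incidence E j i)
      (fun i _ => by simpa using hinc j i) (Finset.mem_univ i)
    simpa [incidence, hi] using this
  have htr : ∀ x ∈ Q, (fun i => min (x i) 1) ∈ Q := by
    rintro x ⟨h0, h1⟩
    have hn : ∀ i, 0 ≤ min (x i) 1 := fun i => le_min (h0 i) zero_le_one
    refine ⟨hn, fun j => ?_⟩
    by_cases h : ∃ i ∈ E j, 1 ≤ x i
    · obtain ⟨i, hi, hxi⟩ := h
      have := Finset.single_le_sum (f := fun i => min (x i) 1 * incidence E j i)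
        (fun i _ => mul_nonneg (hn i) (hinc j i)) (Finset.mem_univ i)
      refine le_trans ?_ this
      simp [incidence, hi, hxi]
    · push Not at h
      refine (h1 j).trans (Finset.sum_le_sum fun i _ => ?_)
      by_cases hi : i ∈ E j
      · simp [incidence, hi, (h i hi).le]
      · simp [incidence, hi]
  -- step 1
  have hK : IsCompact (Q ∩ Set.Icc 0 (fun _ => 1)) := isCompact_Icc.inter_left hQc
  obtain ⟨z, ⟨hzQ, hzI⟩, hz⟩ := hK.exists_isMinOn (f := fun x => ∑ i, α i * x i)
    ⟨_, hone, fun _ => zero_le_one, le_refl _⟩ (by fun_prop)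
  have hzmin : ∀ x ∈ Q, ∑ i, α i * z i ≤ ∑ i, α i * x i := by
    intro x hx
    have := hz (a := fun i => min (x i) 1)
      ⟨htr x hx, fun i => (htr x hx).1 i, fun i => min_le_right _ _⟩
    refine le_trans this (Finset.sum_le_sum fun i _ => ?_)
    exact mul_le_mul_of_nonneg_left (min_le_left _ _) (hα i)
  set c := ∑ i, α i * z i with hc
  -- step 2
  set F : Set (Fin n → ℝ) := {x ∈ Q | ∑ i, α i * x i = c} with hF
  have hFc : IsClosed F := hQc.inter (isClosed_eq (by fun_prop) continuous_const)
  have hK2 : IsCompact (F ∩ Set.Icc 0 (fun _ => ∑ i, z i)) := isCompact_Icc.inter_left hFc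
  have hle : ∀ x ∈ Q, ∑ i, x i ≤ ∑ i, z i → x ∈ Set.Icc (0 : Fin n → ℝ) (fun _ => ∑ i, z i) := by
    intro x hx hs
    refine ⟨fun i => hx.1 i, fun i => le_trans ?_ hs⟩
    exact Finset.single_le_sum (f := x) (fun i _ => hx.1 i) (Finset.mem_univ i)
  obtain ⟨w, ⟨hwF, hwI⟩, hw⟩ := hK2.exists_isMinOn (f := fun x => ∑ i, x i)
    ⟨z, ⟨hzQ, rfl⟩, hle z hzQ le_rfl⟩ (by fun_prop)
  have hwz : ∑ i, w i ≤ ∑ i, z i := hw (a := z) ⟨⟨hzQ, rfl⟩, hle z hzQ le_rfl⟩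
  have hwmin : ∀ x ∈ F, ∑ i, w i ≤ ∑ i, x i := by
    intro x hx
    by_cases h : ∑ i, x i ≤ ∑ i, z i
    · exact hw (a := x) ⟨hx, hle x hx.1 h⟩
    · linarith
  set G : Set (Fin n → ℝ) := {x ∈ F | ∑ i, x i = ∑ i, w i} with hG
  have hGc : IsCompact G := by
    refine hK2.of_isClosed_subset (hFc.inter (isClosed_eq (by fun_prop) continuous_const)) ?_
    rintro x ⟨hx, hs⟩
    exact ⟨hx, hle x hx.1 (by linarith)⟩
  obtain ⟨x, hx⟩ := hGc.extremePoints_nonempty ⟨w, hwF, rfl⟩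
  have hface : ∀ (A : Set (Fin n → ℝ)) (β : Fin n → ℝ) (d : ℝ),
      (∀ x ∈ A, d ≤ ∑ i, β i * x i) → IsExtreme ℝ A {x ∈ A | ∑ i, β i * x i = d} := by
    intro A β d hd
    refine ⟨fun x hx => hx.1, ?_⟩
    rintro y hy y' hy' x ⟨hxA, hxd⟩ ⟨s, t, hs, ht, hst, rfl⟩
    refine ⟨hy, le_antisymm ?_ (hd y hy)⟩
    have h1 := hd y hy
    have h2 := hd y' hy'
    have h3 : ∑ i, β i * (s • y + t • y') i = s * ∑ i, β i * y i + t * ∑ i, β i * y' i := by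
      rw [Finset.mul_sum, Finset.mul_sum, ← Finset.sum_add_distrib]
      refine Finset.sum_congr rfl fun i _ => ?_
      simp; ring
    rw [h3] at hxd
    by_contra hlt
    push Not at hlt
    have := mul_lt_mul_of_pos_left hlt hs
    have := mul_le_mul_of_nonneg_left h2 ht.le
    have : s * d + t * d = d := by rw [← add_mul, hst, one_mul]
    linarith
  have hFQ : IsExtreme ℝ Q F := hface Q α c hzmin
  have hGF : IsExtreme ℝ F G := by
    have := hface F (fun _ => 1) (∑ i, w i) (by simpa using hwmin)
    simpa using this
  refine ⟨x, (hFQ.trans hGF).extremePoints_subset_extremePoints hx, fun x' hx' => ?_⟩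
  have : ∑ i, α i * x i = c := hx.1.1.2
  rw [this]
  exact hzmin x' hx'

theorem exists_le_sum_eq {q : ℕ} (y : Fin q → ℕ) (m : ℕ) (h : m ≤ ∑ j, y j) :
    ∃ b : Fin q → ℕ, (∀ j, b j ≤ y j) ∧ ∑ j, b j = m := by
  induction m with
  | zero => exact ⟨0, by simp, by simp⟩
  | succ m ih =>
    obtain ⟨b, hb, hs⟩ := ih (by omega)
    have : ∃ j, b j < y j := by
      by_contra hcon
      push Not at hcon
      have := Finset.sum_le_sum fun j (_ : j ∈ Finset.univ) => hcon j
      omega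
    obtain ⟨j, hj⟩ := this
    refine ⟨b + Pi.single j 1, fun k => ?_, ?_⟩
    · by_cases hk : k = j
      · subst hk; simpa using hj
      · simpa [hk] using hb k
    · simp [Finset.sum_add_distrib, hs]

theorem nat_of_int {m : ℕ} {x : Fin m → ℝ} (h : IsIntegralVec x) (h0 : ∀ i, 0 ≤ x i) :
    ∃ k : Fin m → ℕ, ∀ i, x i = k i := by
  choose z hz using h
  refine ⟨fun i => (z i).toNat, fun i => ?_⟩
  have : 0 ≤ z i := by have := h0 i; rw [hz i] at this; exact_mod_cast this
  have h2 : ((z i).toNat : ℤ) = z i := Int.toNat_of_nonneg this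
  rw [hz i]
  exact_mod_cast h2.symm

theorem mfmc_integral {n q : ℕ} (E : Fin q → Finset (Fin n)) (h : HasMFMC E) :
    IntegralPolyhedron (incidence E) := by
  classical
  intro x hx
  obtain ⟨⟨hx0, hx1⟩, hext⟩ := hx
  set T : Finset (Fin q) := Finset.univ.filter fun j => ∑ i, x i * incidence E j i = 1 with hT
  set Z : Finset (Fin n) := Finset.univ.filter fun i => x i = 0 with hZ
  set α : Fin n → ℕ := fun i => (∑ j ∈ T, if i ∈ E j then 1 else 0) + if i ∈ Z then 1 else 0
    with hα
  have hval : ∀ w : Fin n → ℝ, ∑ i, (α i : ℝ) * w i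
      = ∑ j ∈ T, ∑ i, w i * incidence E j i + ∑ i ∈ Z, w i := by
    intro w
    rw [Finset.sum_comm]
    have : ∑ i ∈ Z, w i = ∑ i, if i ∈ Z then w i else 0 := by simp
    rw [this, ← Finset.sum_add_distrib]
    refine Finset.sum_congr rfl fun i _ => ?_
    simp only [hα]
    push_cast
    rw [add_mul, Finset.sum_mul]
    congr 1
    · refine Finset.sum_congr rfl fun j _ => ?_
      simp [incidence]
    · split_ifs <;> simp
  obtain ⟨⟨w, hwint, hw0, hw1, hwmin⟩, -⟩ := h α
  have hxw := hwmin x hx0 hx1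
  rw [hval, hval] at hxw
  have hxT : ∑ j ∈ T, ∑ i, x i * incidence E j i = ∑ j ∈ T, 1 :=
    Finset.sum_congr rfl fun j hj => by simpa [hT] using hj
  have hxZ : ∑ i ∈ Z, x i = 0 := Finset.sum_eq_zero fun i hi => by simpa [hZ] using hi
  have hwT : ∑ j ∈ T, (1 : ℝ) ≤ ∑ j ∈ T, ∑ i, w i * incidence E j i :=
    Finset.sum_le_sum fun j _ => hw1 j
  have hwZ : 0 ≤ ∑ i ∈ Z, w i := Finset.sum_nonneg fun i _ => hw0 i
  have hwT' : ∀ j ∈ T, 1 = ∑ i, w i * incidence E j i :=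
    (Finset.sum_eq_sum_iff_of_le fun j _ => hw1 j).1 (by linarith)
  have hwZ' : ∀ i ∈ Z, w i = 0 :=
    (Finset.sum_eq_zero_iff_of_nonneg fun i _ => hw0 i).1 (by linarith)
  -- small perturbation
  have key : ∃ ε : ℝ, 0 < ε ∧ x + ε • (w - x) ∈ coveringPolyhedron (incidence E) ∧
      x - ε • (w - x) ∈ coveringPolyhedron (incidence E) := by
    have hev : ∀ s : ℝ, ∀ᶠ ε in nhdsWithin (0 : ℝ) (Set.Ioi 0),
        x + (s * ε) • (w - x) ∈ coveringPolyhedron (incidence E) := by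
      intro s
      have e1 : ∀ i, ∀ᶠ ε in nhdsWithin (0 : ℝ) (Set.Ioi 0),
          0 ≤ (x + (s * ε) • (w - x)) i := by
        intro i
        by_cases hi : i ∈ Z
        · have h1 := hwZ' i hi
          have h2 : x i = 0 := by simpa [hZ] using hi
          simp [h1, h2]
        · have h2 : 0 < x i := lt_of_le_of_ne (hx0 i) fun h => hi (by simp [hZ, h.symm])
          have hc : Filter.Tendsto (fun ε : ℝ => (x + (s * ε) • (w - x)) i) (nhds 0)
              (nhds ((x + (s * 0) • (w - x)) i)) :=
            Continuous.tendsto (by simp only [Pi.add_apply, Pi.smul_apply]; fun_prop) 0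
          have := hc.eventually_const_lt (u := 0) (by simpa using h2)
          exact (this.filter_mono nhdsWithin_le_nhds).mono fun _ h => h.le
      have e2 : ∀ j, ∀ᶠ ε in nhdsWithin (0 : ℝ) (Set.Ioi 0),
          1 ≤ ∑ i, (x + (s * ε) • (w - x)) i * incidence E j i := by
        intro j
        have hex : ∀ ε : ℝ, ∑ i, (x + (s * ε) • (w - x)) i * incidence E j i
            = (∑ i, x i * incidence E j i) + (s * ε) *
              (∑ i, w i * incidence E j i - ∑ i, x i * incidence E j i) := by
          intro ε
          rw [← Finset.sum_sub_distrib, Finset.mul_sum, ← Finset.sum_add_distrib]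
          refine Finset.sum_congr rfl fun i _ => ?_
          simp; ring
        simp only [hex]
        by_cases hj : j ∈ T
        · have h1 := hwT' j hj
          have h2 : ∑ i, x i * incidence E j i = 1 := by simpa [hT] using hj
          simp [← h1, h2]
        · have h2 : 1 < ∑ i, x i * incidence E j i :=
            lt_of_le_of_ne (hx1 j) fun h => hj (by simp [hT, h.symm])
          set X := ∑ i, x i * incidence E j i
          set W := ∑ i, w i * incidence E j i
          have hc : Filter.Tendsto (fun ε : ℝ => X + (s * ε) * (W - X)) (nhds 0)
              (nhds (X + (s * 0) * (W - X))) :=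
            Continuous.tendsto (by fun_prop) 0
          have := hc.eventually_const_lt (u := 1) (by simpa using h2)
          exact (this.filter_mono nhdsWithin_le_nhds).mono fun _ h => h.le
      filter_upwards [Filter.eventually_all.2 e1, Filter.eventually_all.2 e2] with ε h1 h2
      exact ⟨h1, h2⟩
    obtain ⟨ε, ⟨h1, h2⟩, h3⟩ := ((hev 1).and (hev (-1))).and self_mem_nhdsWithin |>.exists
    refine ⟨ε, h3, by simpa using h1, by
      rwa [neg_one_mul, neg_smul, ← sub_eq_add_neg] at h2⟩
  obtain ⟨ε, hε, hp, hm⟩ := key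
  have heq := hext hp hm ⟨1/2, 1/2, by norm_num, by norm_num, by norm_num, by
    ext i; simp; ring⟩
  have hwx : w = x := by
    have h1 : ε • (w - x) = 0 := by simpa using heq
    exact sub_eq_zero.1 ((smul_eq_zero.1 h1).resolve_left hε.ne')
  rw [← hwx]; exact hwint

theorem mfmc_normal {n q : ℕ} (E : Fin q → Finset (Fin n)) (h : HasMFMC E) :
    NormalReesAlgebra (incidence E) := by
  have hinc : ∀ j i, 0 ≤ incidence E j i := by
    intro j i; unfold incidence; split_ifs <;> norm_num
  have hincN : ∀ j i, incidence E j i = ((if i ∈ E j then 1 else 0 : ℕ) : ℝ) := by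
    intro j i; unfold incidence; split_ifs <;> norm_num
  apply Set.Subset.antisymm
  · rintro x ⟨a, b, hx⟩
    refine ⟨⟨fun i => a i, fun j => b j, fun i => Nat.cast_nonneg _, fun j => Nat.cast_nonneg _,
      hx⟩, ?_⟩
    rw [decomp_iff _ (fun i => (a i : ℝ)) (fun j => (b j : ℝ))] at hx
    intro i
    refine Fin.lastCases ?_ (fun i => ?_) i
    · exact ⟨∑ j, (b j : ℤ), by rw [hx.2]; push_cast; rfl⟩
    · refine ⟨a i + ∑ j, (b j : ℤ) * ((if i ∈ E j then 1 else 0 : ℕ) : ℤ), ?_⟩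
      rw [hx.1 i]; simp only [hincN]; push_cast; rfl
  · rintro x ⟨⟨a, b, ha, hb, hx⟩, hint⟩
    rw [decomp_iff] at hx
    obtain ⟨hx1, hx2⟩ := hx
    have hx0 : ∀ i, 0 ≤ x i := by
      intro i
      refine Fin.lastCases ?_ (fun i => ?_) i
      · rw [hx2]; exact Finset.sum_nonneg fun j _ => hb j
      · rw [hx1]; exact add_nonneg (ha i)
          (Finset.sum_nonneg fun j _ => mul_nonneg (hb j) (hinc j i))
    obtain ⟨k, hk⟩ := nat_of_int hint hx0
    obtain ⟨-, y, hyint, hy0, hy1, hymax⟩ := h (fun i => k i.castSucc)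
    obtain ⟨y', hy'⟩ := nat_of_int hyint hy0
    have hle := hymax b hb fun i => by
      rw [← hk, hx1]; linarith [ha i]
    rw [← hx2, hk] at hle
    simp only [hy'] at hle hy1
    obtain ⟨c, hc, hcs⟩ := exists_le_sum_eq y' (k (Fin.last n)) (by exact_mod_cast hle)
    have hc1 : ∀ i, ∑ j, c j * (if i ∈ E j then 1 else 0) ≤ k i.castSucc := by
      intro i
      have h1 := hy1 i
      simp only [hincN] at h1
      have h2 : ∑ j, y' j * (if i ∈ E j then 1 else 0) ≤ k i.castSucc := by exact_mod_cast h1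
      exact (Finset.sum_le_sum fun j _ => Nat.mul_le_mul_right _ (hc j)).trans h2
    refine ⟨fun i => k i.castSucc - ∑ j, c j * (if i ∈ E j then 1 else 0), c, ?_⟩
    rw [decomp_iff _ (fun i => ((k (Fin.castSucc i) - ∑ j, c j * (if i ∈ E j then 1 else 0) : ℕ) : ℝ))
      (fun j => (c j : ℝ))]
    refine ⟨fun i => ?_, ?_⟩
    · rw [hk, Nat.cast_sub (hc1 i)]
      simp only [hincN]
      push_cast
      ring
    · rw [hk, ← hcs]; push_cast; rfl

theorem mfmc_of {n q : ℕ} (E : Fin q → Finset (Fin n)) (hE : ∀ j, (E j).Nonempty)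
    (hI : IntegralPolyhedron (incidence E)) (hN : NormalReesAlgebra (incidence E)) :
    HasMFMC E := by
  intro α
  obtain ⟨x, hx, hxmin⟩ := exists_min_extreme E hE (fun i => (α i : ℝ)) fun i => Nat.cast_nonneg _
  have hxint := hI x hx
  have hxQ := hx.1
  refine ⟨⟨x, hxint, hxQ.1, hxQ.2, fun x' h0 h1 => hxmin x' ⟨h0, h1⟩⟩, ?_⟩
  obtain ⟨k, hk⟩ := nat_of_int hxint hxQ.1
  obtain ⟨b, hb0, hb1, hb2⟩ := farkas_aux E hE (fun i => (α i : ℝ)) (fun i => Nat.cast_nonneg _)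
    _ hxmin
  -- weak duality
  have weak : ∀ y' : Fin q → ℝ, (∀ j, 0 ≤ y' j) → (∀ i, ∑ j, y' j * incidence E j i ≤ α i) →
      ∑ j, y' j ≤ ∑ i, (α i : ℝ) * x i := by
    intro y' h0 h1
    calc ∑ j, y' j ≤ ∑ j, y' j * ∑ i, x i * incidence E j i :=
          Finset.sum_le_sum fun j _ => le_mul_of_one_le_right (h0 j) (hxQ.2 j)
      _ = ∑ i, (∑ j, y' j * incidence E j i) * x i := by
          simp only [Finset.mul_sum, Finset.sum_mul]
          rw [Finset.sum_comm]
          refine Finset.sum_congr rfl fun i _ => Finset.sum_congr rfl fun j _ => by ring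
      _ ≤ _ := Finset.sum_le_sum fun i _ => mul_le_mul_of_nonneg_right (h1 i) (hxQ.1 i)
  have hbs : ∑ j, b j = ∑ i, (α i : ℝ) * x i := le_antisymm (weak b hb0 hb1) hb2
  have hmem : (Fin.snoc (fun i => (α i : ℝ)) (∑ j, b j) : Fin (n + 1) → ℝ)
      ∈ reesSemigroup (incidence E) := by
    rw [hN]
    refine ⟨⟨fun i => α i - ∑ j, b j * incidence E j i, b, fun i => sub_nonneg.2 (hb1 i), hb0, ?_⟩,
      ?_⟩
    · rw [decomp_iff]; simp
    · intro i
      refine Fin.lastCases ?_ (fun i => ?_) i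
      · refine ⟨∑ i, (α i : ℤ) * k i, ?_⟩
        simp [hbs, hk]
      · exact ⟨α i, by simp⟩
  obtain ⟨a, c, hac⟩ := hmem
  rw [decomp_iff _ (fun i => (a i : ℝ)) (fun j => (c j : ℝ))] at hac
  obtain ⟨h1, h2⟩ := hac
  simp only [Fin.snoc_castSucc, Fin.snoc_last] at h1 h2
  refine ⟨fun j => c j, fun j => ⟨c j, by simp⟩, fun j => Nat.cast_nonneg _, fun i => ?_, ?_⟩
  · rw [h1 i]; have : (0 : ℝ) ≤ a i := Nat.cast_nonneg _
    linarith
  · intro y' hy0 hy1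
    rw [← h2, hbs]; exact weak y' hy0 hy1

/-- Let `𝒞` be a clutter with incidence matrix `A` (columns `v₁, …, v_q ∈ {0,1}ⁿ`).  Then `𝒞`
has the max-flow min-cut property if and only if `Q(A)` is an integral polyhedron and
`ℕ𝒜′ = ℤ^{n+1} ∩ ℝ₊𝒜′` (equivalently, the Rees algebra `R[It]` of the edge ideal of `𝒞` is a
normal domain). -/
theorem stmt5 {n q : ℕ} (E : Fin q → Finset (Fin n)) (hE : IsClutter E) :
    HasMFMC E ↔ IntegralPolyhedron (incidence E) ∧ NormalReesAlgebra (incidence E) := by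
  exact ⟨fun h => ⟨mfmc_integral E h, mfmc_normal E h⟩, fun h => mfmc_of E hE.1 h.1 h.2⟩
end

section
/- Let 𝒞 be a clutter with incidence matrix A having columns v_1,…,v_q ∈ {0,1}^n. If 𝒞 has the max-flow min-cut property, then ℕ𝒜′ = ℤ^{n+1} ∩ ℝ_+𝒜′, i.e., every integer vector in the Rees cone is a nonnegative integer combination of 𝒜′ = {e_1,…,e_n,(v_1,1),…,(v_q,1)} (equivalently, the Rees algebra R[It] of the edge ideal I of 𝒞 is normal). -/
open Finset

lemma rees_exists_le_sum {q : ℕ} (f : Fin q → ℕ) (m : ℕ) (h : m ≤ ∑ j, f j) :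
    ∃ g : Fin q → ℕ, (∀ j, g j ≤ f j) ∧ ∑ j, g j = m := by
  induction m with
  | zero => exact ⟨fun _ => 0, fun _ => Nat.zero_le _, by simp⟩
  | succ m ih =>
    obtain ⟨g, hg, hs⟩ := ih (by omega)
    have : ∃ j, g j < f j := by
      by_contra hc
      push Not at hc
      have := Finset.sum_le_sum (s := Finset.univ) (fun j _ => hc j)
      omega
    obtain ⟨j, hj⟩ := this
    refine ⟨fun k => g k + (if k = j then 1 else 0), fun k => ?_, ?_⟩
    · have := hg k
      by_cases hk : k = j
      · subst hk; simp; omega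
      · simp [hk, this]
    · rw [Finset.sum_add_distrib, hs]; simp

lemma rees_eq_iff {n q : ℕ} (v : Fin q → Fin n → ℝ) (a : Fin n → ℝ) (b : Fin q → ℝ)
    (x : Fin (n + 1) → ℝ) :
    x = (∑ i, a i • (Pi.single (Fin.castSucc i) 1 : Fin (n + 1) → ℝ)) +
        ∑ j, b j • (Fin.snoc (v j) 1 : Fin (n + 1) → ℝ) ↔
    (∀ i : Fin n, x (Fin.castSucc i) = a i + ∑ j, b j * v j i) ∧
      x (Fin.last n) = ∑ j, b j := by
  rw [funext_iff, Fin.forall_fin_succ']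
  simp [Finset.sum_apply, Pi.single_apply, Fin.snoc_castSucc, Fin.snoc_last, (Fin.castSucc_lt_last _).ne']

/-- If the clutter `𝒞` (with incidence columns `v₁, …, v_q ∈ {0,1}ⁿ`) has the max-flow min-cut
property, then `ℕ𝒜′ = ℤ^{n+1} ∩ ℝ₊𝒜′`, i.e. every integer vector of the Rees cone is a
nonnegative integer combination of `𝒜′ = {e₁, …, eₙ, (v₁,1), …, (v_q,1)}` (equivalently, the
Rees algebra `R[It]` of the edge ideal of `𝒞` is normal). -/
theorem stmt6 {n q : ℕ} (E : Fin q → Finset (Fin n)) (hE : IsClutter E)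
    (hmfmc : HasMFMC E) : NormalReesAlgebra (incidence E) := by
  have hinc : ∀ j i, incidence E j i = ((if i ∈ E j then 1 else 0 : ℕ) : ℝ) := by
    intro j i
    simp [incidence]
  ext x
  constructor
  · rintro ⟨a, b, hx⟩
    refine ⟨⟨fun i => a i, fun j => b j, fun i => Nat.cast_nonneg _,
      fun j => Nat.cast_nonneg _, hx⟩, ?_⟩
    obtain ⟨h1, h2⟩ := (rees_eq_iff _ _ _ _).1 hx
    intro k
    refine Fin.lastCases ?_ (fun i => ?_) k
    · exact ⟨((∑ j, b j : ℕ) : ℤ), by rw [h2]; push_cast; rfl⟩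
    · refine ⟨((a i + ∑ j, b j * (if i ∈ E j then 1 else 0) : ℕ) : ℤ), ?_⟩
      rw [h1 i]
      simp only [hinc]
      push_cast
      rfl
  · rintro ⟨⟨a, b, ha, hb, hx⟩, hint⟩
    obtain ⟨h1, h2⟩ := (rees_eq_iff _ _ _ _).1 hx
    have hinc0 : ∀ j i, 0 ≤ incidence E j i := fun j i => by
      rw [hinc]; exact Nat.cast_nonneg _
    have hnn : ∀ k, 0 ≤ x k := by
      intro k
      refine Fin.lastCases ?_ (fun i => ?_) k
      · rw [h2]; exact Finset.sum_nonneg fun j _ => hb j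
      · rw [h1 i]
        exact add_nonneg (ha i) (Finset.sum_nonneg fun j _ => mul_nonneg (hb j) (hinc0 j i))
    have hnat : ∀ {m : ℕ} (w : Fin m → ℝ), IsIntegralVec w → (∀ i, 0 ≤ w i) →
        ∃ N : Fin m → ℕ, ∀ i, w i = N i := by
      intro m w hw hw0
      have : ∀ i, ∃ k : ℕ, w i = k := by
        intro i
        obtain ⟨z, hz⟩ := hw i
        have h0 : 0 ≤ z := by have := hw0 i; rw [hz] at this; exact_mod_cast this
        lift z to ℕ using h0
        exact ⟨z, by rw [hz]; simp⟩
      choose N hN using this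
      exact ⟨N, hN⟩
    obtain ⟨X, hX⟩ := hnat x hint hnn
    obtain ⟨-, y, hyi, hy0, hyα, hyopt⟩ := hmfmc (fun i => X (Fin.castSucc i))
    obtain ⟨Y, hY⟩ := hnat y hyi hy0
    have hle : ∑ j, b j ≤ ∑ j, y j := by
      refine hyopt b hb fun i => ?_
      rw [← hX, h1 i]
      linarith [ha i]
    rw [← h2, hX] at hle
    simp only [hY] at hle hyα
    obtain ⟨g, hg, hgs⟩ := rees_exists_le_sum Y (X (Fin.last n)) (by exact_mod_cast hle)
    have hgα : ∀ i, ∑ j, g j * (if i ∈ E j then 1 else 0) ≤ X (Fin.castSucc i) := by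
      intro i
      have h3 := hyα i
      simp only [hinc] at h3
      have h4 : ∑ j, Y j * (if i ∈ E j then 1 else 0) ≤ X (Fin.castSucc i) := by
        exact_mod_cast h3
      exact le_trans (Finset.sum_le_sum fun j _ => Nat.mul_le_mul_right _ (hg j)) h4
    refine ⟨fun i => X (Fin.castSucc i) - ∑ j, g j * (if i ∈ E j then 1 else 0), g, ?_⟩
    refine (rees_eq_iff _ (fun i => ((X (Fin.castSucc i) -
      ∑ j, g j * (if i ∈ E j then 1 else 0) : ℕ) : ℝ)) (fun j => (g j : ℝ)) _).2 ⟨fun i => ?_, ?_⟩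
    · rw [hX]
      simp only [hinc]
      rw [Nat.cast_sub (hgα i)]
      push_cast
      ring
    · rw [hX, ← hgs]; push_cast; rfl
end

section
/- Let 𝒞 be a clutter with edge ideal I = I(𝒞) in R = K[x_1,…,x_n]. If the associated graded ring gr_I(R) = R[It]/IR[It] is reduced, then α_0(𝒞′) = β_1(𝒞′) for every minor 𝒞′ of 𝒞, i.e., for every minor the minimum size of a vertex cover equals the maximum number of pairwise disjoint edges. -/
open Finset Polynomial

/-- `α₀` of a family `F` of edges: the smallest number of vertices in a vertex cover of `F`
(a set of vertices meeting every edge of `F`). -/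
noncomputable def alpha0F {n : ℕ} (F : Finset (Finset (Fin n))) : ℕ :=
  sInf {k | ∃ C : Finset (Fin n), C.card = k ∧ ∀ S ∈ F, (S ∩ C).Nonempty}

/-- `β₁` of a family `F` of edges: the maximum number of pairwise disjoint (independent) edges
of `F`. -/
noncomputable def beta1F {n : ℕ} (F : Finset (Finset (Fin n))) : ℕ :=
  sSup {k | ∃ M : Finset (Finset (Fin n)), M ⊆ F ∧ M.card = k ∧
    ∀ S ∈ M, ∀ T ∈ M, S ≠ T → Disjoint S T}

open Classical in
/-- The minor of the clutter with edge set `E` obtained by making `x_i = 0` for `i ∈ D` and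
`x_i = 1` for `i ∈ C`: edges containing a vertex of `D` are deleted, the vertices of `C` are
removed from the remaining edges, and the minimal resulting sets are taken (these correspond to
the minimal monomial generators of the minor ideal `I′`). -/
noncomputable def minorEdges {n : ℕ} (E : Finset (Finset (Fin n))) (D C : Finset (Fin n)) :
    Finset (Finset (Fin n)) :=
  ((E.filter fun S => S ∩ D = ∅).image fun S => S \ C).filter fun T =>
    ∀ T' ∈ (E.filter fun S => S ∩ D = ∅).image fun S => S \ C, T' ⊆ T → T' = T

theorem wstep {n : ℕ} (v : (Fin n →₀ ℕ) → ℕ) (u : Fin n →₀ ℕ)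
    (hs : ∀ x y, v x + v y ≤ v (x + y)) (hh : ∀ (p : ℕ) x, v (p • x) = p * v x)
    (hb : ∀ x i, v (x + Finsupp.single i 1) ≤ v x + 1) :
    ∃ w : (Fin n →₀ ℕ) → ℕ, (∀ x y, w x + w y ≤ w (x + y)) ∧
      (∀ (p : ℕ) x, w (p • x) = p * w x) ∧
      (∀ x i, w (x + Finsupp.single i 1) ≤ w x + 1) ∧
      (∀ x, v x ≤ w x) ∧ (∀ c, w (u + c) = w u + w c) ∧ w u = v u ∧
      ∀ b, (∀ c, v (b + c) = v b + v c) → (∀ c, w (b + c) = w b + w c) ∧ w b = v b := by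
  have hbd : ∀ c, ∃ B, ∀ x, v (x + c) ≤ v x + B := by
    intro c
    induction c using Finsupp.induction_linear with
    | zero => exact ⟨0, fun x => by simp⟩
    | add f g hf hg =>
      obtain ⟨B1, h1⟩ := hf
      obtain ⟨B2, h2⟩ := hg
      refine ⟨B1 + B2, fun x => ?_⟩
      have := h1 x
      have := h2 (x + f)
      rw [← add_assoc]; omega
    | single i m =>
      refine ⟨m, fun x => ?_⟩
      induction m with
      | zero => simp
      | succ m ih =>
        rw [Finsupp.single_add, ← add_assoc]
        have := hb (x + Finsupp.single i m) i
        omega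
  have hv0 : v 0 = 0 := by have := hs 0 0; simp at this; exact this
  -- eventual value
  have key : ∀ c, ∃ k N0, v c ≤ k ∧ ∀ N, N0 ≤ N → v (N • u + c) = N * v u + k := by
    intro c
    obtain ⟨B, hB⟩ := hbd c
    have hlow : ∀ N, N * v u + v c ≤ v (N • u + c) := by
      intro N; have := hs (N • u) c; rw [hh] at this; exact this
    have hmono : ∀ N M, M * v u + v (N • u + c) ≤ v ((M + N) • u + c) := by
      intro N M
      have := hs (M • u) (N • u + c)
      rw [hh, ← add_assoc, ← add_smul] at this; exact this
    let P : ℕ → Prop := fun k => ∃ N, N * v u + k ≤ v (N • u + c)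
    have hPB : ∀ k, P k → k ≤ B := by
      rintro k ⟨N, hN⟩
      have := hB (N • u); rw [hh] at this; omega
    classical
    have hP0 : P (v c) := ⟨0, by simp⟩
    have hsp : P (Nat.findGreatest P B) := Nat.findGreatest_spec (hPB _ hP0) hP0
    obtain ⟨N0, hN0⟩ := hsp
    refine ⟨Nat.findGreatest P B, N0, Nat.le_findGreatest (hPB _ hP0) hP0, fun N hN => ?_⟩
    obtain ⟨M, rfl⟩ := Nat.exists_eq_add_of_le' hN
    apply le_antisymm
    · by_contra hcon
      have hP : P (Nat.findGreatest P B + 1) := ⟨M + N0, by omega⟩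
      have := Nat.le_findGreatest (hPB _ hP) hP
      omega
    · have := hmono N0 M
      rw [add_mul]; omega
  choose w N0 hvw hw using key
  have uniq : ∀ c k N, N0 c ≤ N → v (N • u + c) = N * v u + k → w c = k := by
    intro c k N h1 h2
    have := hw c N h1
    omega
  have w0 : w 0 = 0 := uniq 0 0 (N0 0) le_rfl (by simp [hh])
  have hwu : ∀ c, w (u + c) = v u + w c := by
    intro c
    apply uniq (u + c) _ (N0 (u + c) + N0 c) (by omega)
    have := hw c (N0 (u + c) + N0 c + 1) (by omega)
    rw [add_smul, one_smul, add_assoc] at this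
    rw [this]; ring
  have hwuu : w u = v u := by have := hwu 0; rw [add_zero, w0] at this; exact this
  refine ⟨w, ?_, ?_, ?_, hvw, fun c => by rw [hwu, hwuu], hwuu, ?_⟩
  · intro x y
    let N := N0 x + N0 y + N0 (x + y)
    have h1 := hw x N (by omega)
    have h2 := hw y N (by omega)
    have h3 := hw (x + y) (N + N) (by omega)
    have h4 := hs (N • u + x) (N • u + y)
    have : N • u + x + (N • u + y) = (N + N) • u + (x + y) := by
      rw [add_smul N N, add_add_add_comm]
    rw [this, h3, add_mul] at h4
    omega
  · intro p x
    rcases Nat.eq_zero_or_pos p with rfl | hp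
    · simp [w0]
    let N := N0 x + N0 (p • x)
    have h1 := hw x N (by omega)
    apply uniq (p • x) _ (p * N)
    · calc N0 (p • x) ≤ N := by omega
        _ ≤ p * N := Nat.le_mul_of_pos_left _ hp
    · rw [mul_smul, ← smul_add, hh, h1]; ring
  · intro x i
    let N := N0 x + N0 (x + Finsupp.single i 1)
    have h1 := hw x N (by omega)
    have h2 := hw (x + Finsupp.single i 1) N (by omega)
    have h3 := hb (N • u + x) i
    rw [add_assoc, h2, h1] at h3
    omega
  · intro b hbl
    have h : ∀ c, w (b + c) = v b + w c := by
      intro c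
      apply uniq (b + c) _ (N0 (b + c) + N0 c) (by omega)
      have := hw c (N0 (b + c) + N0 c) (by omega)
      rw [add_left_comm, hbl, this]; ring
    have hb0 : w b = v b := by have := h 0; rw [add_zero, w0] at this; exact this
    exact ⟨fun c => by rw [h, hb0], hb0⟩

theorem wlin {n : ℕ} (L : List (Fin n →₀ ℕ)) : ∀ (v : (Fin n →₀ ℕ) → ℕ) (a : Fin n →₀ ℕ)
    (_ : ∀ x y, v x + v y ≤ v (x + y)) (_ : ∀ (p : ℕ) x, v (p • x) = p * v x)
    (_ : ∀ x i, v (x + Finsupp.single i 1) ≤ v x + 1) (_ : ∀ c, v (a + c) = v a + v c),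
    ∃ w : (Fin n →₀ ℕ) → ℕ, (∀ x i, w (x + Finsupp.single i 1) ≤ w x + 1) ∧
      (∀ x, v x ≤ w x) ∧ w 0 = 0 ∧ w a = v a ∧ (∀ b ∈ L, ∀ c, w (b + c) = w b + w c) ∧
      ∀ b, (∀ c, v (b + c) = v b + v c) → (∀ c, w (b + c) = w b + w c) := by
  induction L with
  | nil =>
    intro v a hs hh hb ha
    exact ⟨v, hb, fun _ => le_rfl, by simpa using hh 0 0, rfl, by simp, fun b h => h⟩
  | cons u L ih =>
    intro v a hs hh hb ha
    obtain ⟨w, h1, h2, h3, h4, h5, h6, h7⟩ := wstep v u hs hh hb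
    obtain ⟨w', k1, k2, k3, k4, k5, k6⟩ := ih w a h1 h2 h3 (h7 a ha).1
    refine ⟨w', k1, fun x => (h4 x).trans (k2 x), k3, k4.trans (h7 a ha).2, ?_, ?_⟩
    · intro b hb
      rcases List.mem_cons.1 hb with rfl | hb
      · exact k6 _ h5
      · exact k5 b hb
    · intro b hb
      exact k6 b (h7 b hb).1

theorem wmain {n : ℕ} (v : (Fin n →₀ ℕ) → ℕ) (a : Fin n →₀ ℕ)
    (hs : ∀ x y, v x + v y ≤ v (x + y)) (hh : ∀ (p : ℕ) x, v (p • x) = p * v x)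
    (hb : ∀ x i, v (x + Finsupp.single i 1) ≤ v x + 1) :
    ∃ P : Finset (Fin n), (∀ c, v c ≤ ∑ i ∈ P, c i) ∧ ∑ i ∈ P, a i = v a := by
  obtain ⟨v', h1, h2, h3, h4, h5, h6, h7⟩ := wstep v a hs hh hb
  obtain ⟨w, k1, k2, k3, k4, k5, k6⟩ :=
    wlin ((Finset.univ : Finset (Fin n)).toList.map fun i => Finsupp.single i 1) v' a h1 h2 h3 h5
  have k5' : ∀ (i : Fin n) c, w (Finsupp.single i 1 + c) = w (Finsupp.single i 1) + w c := by
    intro i; apply k5; simp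
  have hle : ∀ i : Fin n, w (Finsupp.single i 1) ≤ 1 := by
    intro i; have := k1 0 i; simpa [k3] using this
  let P : Finset (Fin n) := Finset.univ.filter fun i => w (Finsupp.single i 1) = 1
  have hadd : ∀ c d, w (c + d) = w c + w d := by
    intro c
    induction c using Finsupp.induction_linear with
    | zero => simp [k3]
    | add f g hf hg => intro d; rw [add_assoc, hf, hg, hf]; ring
    | single i m =>
      intro d
      induction m with
      | zero => simp [k3]
      | succ m ih =>
        rw [add_comm m 1, Finsupp.single_add, add_assoc, k5', ih, k5']; ring
  have hsum : ∀ c, w c = ∑ i ∈ P, c i := by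
    intro c
    induction c using Finsupp.induction_linear with
    | zero => simp [k3]
    | add f g hf hg => rw [hadd, hf, hg, ← Finset.sum_add_distrib]; rfl
    | single i m =>
      have e : w (Finsupp.single i m) = m * w (Finsupp.single i 1) := by
        induction m with
        | zero => simp [k3]
        | succ m ih => rw [Finsupp.single_add, hadd, ih]; ring
      rw [e, Finset.sum_congr rfl (fun j _ => Finsupp.single_apply (a := i) (b := m) (a' := j)),
        Finset.sum_ite_eq]
      have := hle i
      by_cases h : w (Finsupp.single i 1) = 1
      · simp [P, h]
      · have : w (Finsupp.single i 1) = 0 := by omega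
        simp [P, this]
  refine ⟨P, fun c => ?_, ?_⟩
  · rw [← hsum]; exact (h4 c).trans (k2 c)
  · rw [← hsum, k4, h6]

noncomputable def indS {n : ℕ} (S : Finset (Fin n)) : Fin n →₀ ℕ :=
  ∑ i ∈ S, Finsupp.single i 1

theorem indS_apply {n : ℕ} (S : Finset (Fin n)) (i : Fin n) :
    indS S i = if i ∈ S then 1 else 0 := by
  unfold indS
  rw [Finsupp.finsetSum_apply]
  simp [Finsupp.single_apply]

def PackSet {n : ℕ} (E : Finset (Finset (Fin n))) (k : ℕ) : Set (Fin n →₀ ℕ) :=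
  {s | ∃ M : Multiset (Finset (Fin n)), M.card = k ∧ (∀ S ∈ M, S ∈ E) ∧ (M.map indS).sum = s}

def Pack {n : ℕ} (E : Finset (Finset (Fin n))) (k : ℕ) (a : Fin n →₀ ℕ) : Prop :=
  ∃ s ∈ PackSet E k, s ≤ a

theorem pow_eq_span {n : ℕ} (K : Type*) [Field K] (E : Finset (Finset (Fin n))) (k : ℕ) :
    (Ideal.span ((fun S : Finset (Fin n) =>
      (∏ i ∈ S, MvPolynomial.X i : MvPolynomial (Fin n) K)) '' ↑E)) ^ k =
    Ideal.span ((fun s => MvPolynomial.monomial s (1 : K)) '' PackSet E k) := by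
  have hX : ∀ S : Finset (Fin n), (∏ i ∈ S, MvPolynomial.X i : MvPolynomial (Fin n) K) =
      MvPolynomial.monomial (indS S) 1 := by
    intro S
    rw [indS, MvPolynomial.monomial_sum_one]; rfl
  induction k with
  | zero =>
    have : PackSet E 0 = {0} := by
      ext s
      simp only [PackSet, Set.mem_ofPred_eq, Multiset.card_eq_zero, Set.mem_singleton_iff]
      constructor
      · rintro ⟨M, rfl, -, rfl⟩; simp
      · rintro rfl; exact ⟨0, by simp⟩
    rw [this, Set.image_singleton]
    simp
  | succ k ih =>
    rw [pow_succ, ih, Ideal.span_mul_span']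
    congr 1
    ext f
    simp only [Set.mem_mul, Set.mem_image, Finset.mem_coe]
    constructor
    · rintro ⟨_, ⟨s, ⟨M, hM, hE, rfl⟩, rfl⟩, _, ⟨S, hS, rfl⟩, rfl⟩
      refine ⟨indS S + (M.map indS).sum, ⟨S ::ₘ M, by simp [hM], ?_, by simp⟩, ?_⟩
      · intro T hT
        rcases Multiset.mem_cons.1 hT with rfl | hT
        · exact hS
        · exact hE T hT
      · rw [hX, MvPolynomial.monomial_mul, add_comm, one_mul]
    · rintro ⟨s, ⟨M, hM, hE, rfl⟩, rfl⟩
      obtain ⟨S, hSM⟩ := Multiset.exists_mem_of_ne_zero (s := M) (by rintro rfl; simp at hM)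
      obtain ⟨M', rfl⟩ := Multiset.exists_cons_of_mem hSM
      refine ⟨_, ⟨_, ⟨M', by simpa using hM, fun T hT => hE T (Multiset.mem_cons_of_mem hT), rfl⟩,
        rfl⟩, _, ⟨_, hE _ (Multiset.mem_cons_self _ _), rfl⟩, ?_⟩
      rw [hX, MvPolynomial.monomial_mul, add_comm, one_mul, Multiset.map_cons, Multiset.sum_cons]

theorem mem_pow_iff {n : ℕ} (K : Type*) [Field K] (E : Finset (Finset (Fin n))) (k : ℕ)
    (a : Fin n →₀ ℕ) : MvPolynomial.monomial a (1 : K) ∈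
    (Ideal.span ((fun S : Finset (Fin n) =>
      (∏ i ∈ S, MvPolynomial.X i : MvPolynomial (Fin n) K)) '' ↑E)) ^ k ↔ Pack E k a := by
  rw [pow_eq_span, MvPolynomial.mem_ideal_span_monomial_image]
  classical
  simp [MvPolynomial.support_monomial, Pack]

theorem rees_red {R : Type*} [CommRing R] (I : Ideal R)
    (hred : IsReduced ((reesAlgebra I) ⧸ (Ideal.map (algebraMap R (reesAlgebra I)) I)))
    (f : R) (k p : ℕ) (hf : f ∈ I ^ k) (hp : f ^ p ∈ I ^ (p * k + 1)) : f ∈ I ^ (k + 1) := by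
  have hrad := (Ideal.isRadical_iff_quotient_reduced _).2 hred
  let J := Ideal.map (algebraMap R (reesAlgebra I)) I
  have h1 : ∀ m g (hg : g ∈ I ^ (m + 1)),
      (⟨Polynomial.monomial m g, reesAlgebra.monomial_mem.2 (Ideal.pow_le_pow_right (Nat.le_succ m) hg)⟩ :
        reesAlgebra I) ∈ J := by
    intro m g hg
    have hg' := hg
    rw [pow_succ'] at hg'
    induction hg' using Submodule.mul_induction_on' with
    | mem_mul_mem r hr s hs =>
      have e : (⟨Polynomial.monomial m (r * s), reesAlgebra.monomial_mem.2
          (Ideal.pow_le_pow_right (Nat.le_succ m) hg)⟩ : reesAlgebra I) =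
          algebraMap R (reesAlgebra I) r * ⟨Polynomial.monomial m s, reesAlgebra.monomial_mem.2 hs⟩ := by
        apply Subtype.ext
        change _ = Polynomial.C r * Polynomial.monomial m s
        rw [Polynomial.C_mul_monomial]
      rw [e]
      exact Ideal.mul_mem_right _ _ (Ideal.mem_map_of_mem _ hr)
    | add x hx y hy ihx ihy =>
      rw [← pow_succ'] at hx hy
      have := J.add_mem (ihx hx) (ihy hy)
      convert this using 1
      apply Subtype.ext
      simp
  have h2 : ∀ x ∈ J, ∀ i, (x : Polynomial R).coeff i ∈ I ^ (i + 1) := by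
    intro x hx
    induction hx using Submodule.span_induction with
    | mem x h =>
      obtain ⟨r, hr, rfl⟩ := h
      intro i
      change (Polynomial.C r).coeff i ∈ _
      rw [Polynomial.coeff_C]
      split_ifs with h
      · subst h; simpa using hr
      · simp
    | zero => simp
    | add x y _ _ hx hy => intro i; simpa using Ideal.add_mem _ (hx i) (hy i)
    | smul a x _ hx =>
      intro i
      change ((a : Polynomial R) * (x : Polynomial R)).coeff i ∈ _
      rw [Polynomial.coeff_mul]
      apply Ideal.sum_mem
      rintro ⟨j, l⟩ e
      rw [← Finset.HasAntidiagonal.mem_antidiagonal.mp e, add_assoc, pow_add]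
      exact Ideal.mul_mem_mul (a.2 j) (hx l)
  have h3 : (⟨Polynomial.monomial k f, reesAlgebra.monomial_mem.2 hf⟩ : reesAlgebra I) ∈ J := by
    apply hrad
    refine ⟨p, ?_⟩
    have := h1 (p * k) _ hp
    convert this using 1
    apply Subtype.ext
    simp [Polynomial.monomial_pow, mul_comm]
  simpa using h2 _ h3 k

theorem pack_add {n : ℕ} {E : Finset (Finset (Fin n))} {k l : ℕ} {a b : Fin n →₀ ℕ}
    (h1 : Pack E k a) (h2 : Pack E l b) : Pack E (k + l) (a + b) := by
  obtain ⟨_, ⟨M, rfl, hM, rfl⟩, ha⟩ := h1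
  obtain ⟨_, ⟨N, rfl, hN, rfl⟩, hb⟩ := h2
  refine ⟨_, ⟨M + N, by simp, ?_, rfl⟩, ?_⟩
  · intro S hS
    rcases Multiset.mem_add.1 hS with h | h
    · exact hM S h
    · exact hN S h
  · rw [Multiset.map_add, Multiset.sum_add]; exact add_le_add ha hb

theorem pack_mono {n : ℕ} {E : Finset (Finset (Fin n))} {k l : ℕ} {a : Fin n →₀ ℕ}
    (h1 : Pack E k a) (h : l ≤ k) : Pack E l a := by
  induction h using Nat.decreasingInduction with
  | self => exact h1
  | of_succ k _ ih =>
    obtain ⟨_, ⟨M, hc, hM, rfl⟩, ha⟩ := ih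
    obtain ⟨S, hSM⟩ := Multiset.exists_mem_of_ne_zero (s := M) (by rintro rfl; simp at hc)
    obtain ⟨N, rfl⟩ := Multiset.exists_cons_of_mem hSM
    refine ⟨_, ⟨N, by simpa using hc, fun T hT => hM T (Multiset.mem_cons_of_mem hT), rfl⟩,
      le_trans ?_ ha⟩
    rw [Multiset.map_cons, Multiset.sum_cons]; exact le_add_self

theorem pack_sub {n : ℕ} {E : Finset (Finset (Fin n))} {k : ℕ} {a : Fin n →₀ ℕ} {i : Fin n}
    (h1 : Pack E (k + 1) (a + Finsupp.single i 1)) : Pack E k a := by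
  obtain ⟨_, ⟨M, hc, hM, rfl⟩, ha⟩ := h1
  by_cases h : ∃ S ∈ M, i ∈ S
  · obtain ⟨S, hS, hi⟩ := h
    obtain ⟨N, rfl⟩ := Multiset.exists_cons_of_mem hS
    refine ⟨_, ⟨N, by simpa using hc, fun T hT => hM T (Multiset.mem_cons_of_mem hT), rfl⟩, ?_⟩
    intro j
    have := ha j
    rw [Multiset.map_cons, Multiset.sum_cons, Finsupp.add_apply, Finsupp.add_apply,
      indS_apply, Finsupp.single_apply] at this
    by_cases hj : i = j
    · subst hj; simp [hi] at this; omega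
    · simp [hj] at this; omega
  · refine pack_mono (k := k + 1) ⟨_, ⟨M, hc, hM, rfl⟩, ?_⟩ (Nat.le_succ k)
    push Not at h
    have h0 : (M.map indS).sum i = 0 := by
      clear hc hM ha
      induction M using Multiset.induction_on with
      | empty => simp
      | cons S M ih =>
        rw [Multiset.map_cons, Multiset.sum_cons, Finsupp.add_apply, indS_apply,
          if_neg (h S (Multiset.mem_cons_self _ _)),
          ih fun T hT => h T (Multiset.mem_cons_of_mem hT)]
    intro j
    by_cases hj : i = j
    · subst hj; omega
    · have := ha j
      rw [Finsupp.add_apply, Finsupp.single_apply, if_neg hj] at this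
      simpa using this

theorem pack_bdd {n : ℕ} {E : Finset (Finset (Fin n))} (hne : ∀ S ∈ E, S.Nonempty)
    {k : ℕ} {a : Fin n →₀ ℕ} (h : Pack E k a) : k ≤ ∑ i, a i := by
  obtain ⟨_, ⟨M, rfl, hM, rfl⟩, ha⟩ := h
  refine le_trans ?_ (Finset.sum_le_sum fun i _ => ha i)
  clear ha
  induction M using Multiset.induction_on with
  | empty => simp
  | cons S M ih =>
    have h1 := ih fun T hT => hM T (Multiset.mem_cons_of_mem hT)
    have h2 : 1 ≤ ∑ i, indS S i := by
      simp_rw [indS_apply]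
      simpa [Nat.one_le_iff_ne_zero, Finset.nonempty_iff_ne_empty] using
        hne S (hM S (Multiset.mem_cons_self _ _))
    simp only [Multiset.map_cons, Multiset.sum_cons, Finsupp.add_apply, Finset.sum_add_distrib,
      Multiset.card_cons]
    omega

theorem exists_cover {n : ℕ} (K : Type*) [Field K] (E : Finset (Finset (Fin n)))
    (hne : ∀ S ∈ E, S.Nonempty)
    (I : Ideal (MvPolynomial (Fin n) K))
    (hI : I = Ideal.span ((fun S : Finset (Fin n) => ∏ i ∈ S, MvPolynomial.X i) '' ↑E))
    (hred : IsReduced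
      ((reesAlgebra I) ⧸
        (Ideal.map (algebraMap (MvPolynomial (Fin n) K) (reesAlgebra I)) I)))
    (a : Fin n →₀ ℕ) :
    ∃ P : Finset (Fin n), (∀ S ∈ E, (S ∩ P).Nonempty) ∧ Pack E (∑ i ∈ P, a i) a := by
  have hp0 : ∀ a, Pack E 0 a := fun a => ⟨0, ⟨0, by simp⟩, zero_le⟩
  have : ∀ a, ∃ k, Pack E k a ∧ ∀ l, Pack E l a → l ≤ k := by
    intro a
    classical
    exact ⟨Nat.findGreatest (fun k => Pack E k a) (∑ i, a i),
      Nat.findGreatest_spec (P := fun k => Pack E k a) (Nat.zero_le _) (hp0 a),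
      fun l hl => Nat.le_findGreatest (pack_bdd hne hl) hl⟩
  choose v hv hmax using this
  have hs : ∀ x y, v x + v y ≤ v (x + y) := fun x y => hmax _ _ (pack_add (hv x) (hv y))
  have hb : ∀ x i, v (x + Finsupp.single i 1) ≤ v x + 1 := by
    intro x i
    rcases Nat.eq_zero_or_pos (v (x + Finsupp.single i 1)) with h | h
    · omega
    · obtain ⟨k, hk⟩ := Nat.exists_eq_add_of_lt h
      have h2 := hv (x + Finsupp.single i 1)
      rw [hk, zero_add] at h2
      have := hmax _ _ (pack_sub h2)
      omega
  have hlow : ∀ (p : ℕ) x, p * v x ≤ v (p • x) := by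
    intro p x
    induction p with
    | zero => simp
    | succ p ih =>
      have := hs (p • x) x
      rw [add_smul, one_smul, add_mul]; omega
  have hh : ∀ (p : ℕ) x, v (p • x) = p * v x := by
    intro p x
    refine le_antisymm ?_ (hlow p x)
    by_contra hcon
    push Not at hcon
    have h1 : Pack E (p * v x + 1) (p • x) := pack_mono (hv _) hcon
    have h2 : Pack E (v x + 1) x := by
      rw [← mem_pow_iff K, ← hI]
      apply rees_red I hred _ _ p
      · rw [hI, mem_pow_iff]; exact hv x
      · rw [MvPolynomial.monomial_pow, one_pow, hI, mem_pow_iff]; exact h1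
    have := hmax _ _ h2
    omega
  obtain ⟨P, hP, hPa⟩ := wmain v a hs hh hb
  refine ⟨P, fun S hS => ?_, hPa ▸ hv a⟩
  have h1 : 1 ≤ v (indS S) := hmax _ _ ⟨indS S, ⟨{S}, by simp, by simpa using hS, by simp⟩, le_rfl⟩
  have h2 := h1.trans (hP (indS S))
  simp_rw [indS_apply] at h2
  rw [Finset.sum_boole] at h2
  simp only [Nat.cast_id] at h2
  obtain ⟨i, hi⟩ := Finset.card_pos.1 h2
  rw [Finset.mem_filter] at hi
  exact ⟨i, Finset.mem_inter.2 ⟨hi.2, hi.1⟩⟩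

/-- Let `𝒞` be a clutter with edge ideal `I = I(𝒞) ⊆ R = K[x₁, …, xₙ]`.  If the associated
graded ring `gr_I(R) = R[It]/IR[It]` is reduced, then `α₀(𝒞′) = β₁(𝒞′)` for every minor `𝒞′`
of `𝒞`: for every minor, the minimum size of a vertex cover equals the maximum number of
pairwise disjoint edges.  (A minor is obtained by setting the variables of a set `D` to `0`
and those of a disjoint set `C` to `1`, in such a way that the resulting ideal is proper.) -/
theorem stmt8 {n : ℕ} (K : Type*) [Field K] (E : Finset (Finset (Fin n)))
    (hne : ∀ S ∈ E, S.Nonempty) (hanti : ∀ S ∈ E, ∀ T ∈ E, S ⊆ T → S = T)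
    (I : Ideal (MvPolynomial (Fin n) K))
    (hI : I = Ideal.span ((fun S : Finset (Fin n) => ∏ i ∈ S, MvPolynomial.X i) '' ↑E))
    (hred : IsReduced
      ((reesAlgebra I) ⧸
        (Ideal.map (algebraMap (MvPolynomial (Fin n) K) (reesAlgebra I)) I))) :
    ∀ D C : Finset (Fin n), Disjoint D C → (¬ ∃ S ∈ E, S ∩ D = ∅ ∧ S ⊆ C) →
      alpha0F (minorEdges E D C) = beta1F (minorEdges E D C) := by
  intro D C hDC hprop
  set F := minorEdges E D C with hF
  -- facts about F
  have hFmem : ∀ T ∈ F, ∃ S ∈ E, S ∩ D = ∅ ∧ S \ C = T := by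
    intro T hT
    simp only [hF, minorEdges, Finset.mem_filter, Finset.mem_image] at hT
    obtain ⟨⟨S, ⟨h1, h2⟩, h3⟩, -⟩ := hT
    exact ⟨S, h1, h2, h3⟩
  have hFne : ∀ T ∈ F, T.Nonempty := by
    intro T hT
    obtain ⟨S, h1, h2, rfl⟩ := hFmem T hT
    rw [Finset.sdiff_nonempty]
    exact fun h => hprop ⟨S, h1, h2, h⟩
  have hFex : ∀ S ∈ E, S ∩ D = ∅ → ∃ T ∈ F, T ⊆ S \ C := by
    intro S hS hSD
    classical
    let G := (E.filter fun S => S ∩ D = ∅).image fun S => S \ C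
    have hSG : S \ C ∈ G := Finset.mem_image.2 ⟨S, Finset.mem_filter.2 ⟨hS, hSD⟩, rfl⟩
    obtain ⟨T, hTS, hT⟩ := G.exists_le_minimal hSG
    refine ⟨T, ?_, hTS⟩
    simp only [hF, minorEdges]
    rw [Finset.mem_filter]
    refine ⟨?_, ?_⟩
    · convert hT.1
    · intro T' hT' hle
      have hT'' : T' ∈ G := by convert hT'
      exact le_antisymm hle (hT.2 hT'' hle)
  let A := {k | ∃ C : Finset (Fin n), C.card = k ∧ ∀ S ∈ F, (S ∩ C).Nonempty}
  have hA : A.Nonempty := ⟨_, Finset.univ, rfl, fun S hS => by simpa using hFne S hS⟩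
  have hmem : alpha0F F ∈ A := Nat.sInf_mem hA
  let B := {k | ∃ M : Finset (Finset (Fin n)), M ⊆ F ∧ M.card = k ∧
    ∀ S ∈ M, ∀ T ∈ M, S ≠ T → Disjoint S T}
  have hB : ∀ k ∈ B, k ≤ alpha0F F := by
    rintro k ⟨M, hMF, rfl, hM⟩
    obtain ⟨P, hP, hcov⟩ := hmem
    rw [← hP]
    have hM' : ∀ S : M, ∃ i, i ∈ S.1 ∩ P := fun S => hcov S.1 (hMF S.2)
    choose φ hφ using hM'
    have hinj : Function.Injective (fun S : M => (⟨φ S, (Finset.mem_inter.1 (hφ S)).2⟩ : P)) := by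
      intro S T hST
      have hST' : φ S = φ T := congrArg Subtype.val hST
      by_contra hne'
      have h1 := (Finset.mem_inter.1 (hφ S)).1
      have h2 := (Finset.mem_inter.1 (hφ T)).1
      rw [← hST'] at h2
      exact Finset.disjoint_left.1
        (hM S.1 S.2 T.1 T.2 fun h => hne' (Subtype.ext h)) h1 h2
    simpa using Fintype.card_le_of_injective _ hinj
  have hbeta : beta1F F = sSup B := rfl
  apply le_antisymm
  · rw [hbeta]
    apply le_csSup ⟨_, hB⟩
    let g := alpha0F F
    let a : Fin n →₀ ℕ := Finsupp.equivFunOnFinite.symm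
      fun i => if i ∈ D then 0 else if i ∈ C then g else 1
    have ha : ∀ i, a i = if i ∈ D then 0 else if i ∈ C then g else 1 := fun i => rfl
    obtain ⟨P, hP, hPack⟩ := exists_cover K E hne I hI hred a
    have hg : g ≤ ∑ i ∈ P, a i := by
      by_cases h : ∃ c ∈ P, c ∈ C
      · obtain ⟨c, hcP, hcC⟩ := h
        have h1 : a c = g := by
          rw [ha, if_neg (Finset.disjoint_right.1 hDC hcC), if_pos hcC]
        rw [← h1]
        exact Finset.single_le_sum (f := fun i => a i) (fun i _ => Nat.zero_le _) hcP
      · push Not at h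
        have h1 : ∑ i ∈ P, a i = (P \ D).card := by
          rw [Finset.card_eq_sum_ones, ← Finset.sum_sdiff (Finset.inter_subset_left : P ∩ D ⊆ P),
            Finset.sum_eq_zero (s := P ∩ D), add_zero, Finset.sdiff_inter_self_left]
          · apply Finset.sum_congr rfl
            intro i hi
            rw [Finset.mem_sdiff] at hi
            rw [ha, if_neg hi.2, if_neg (h i hi.1)]
          · intro i hi
            rw [ha, if_pos (Finset.mem_inter.1 hi).2]
        rw [h1]
        apply Nat.sInf_le
        refine ⟨P \ D, rfl, ?_⟩
        intro T hT
        obtain ⟨S, hS, hSD, rfl⟩ := hFmem T hT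
        obtain ⟨i, hi⟩ := hP S hS
        rw [Finset.mem_inter] at hi
        refine ⟨i, ?_⟩
        simp only [Finset.mem_inter, Finset.mem_sdiff]
        refine ⟨⟨hi.1, h i hi.2⟩, hi.2, fun hD => ?_⟩
        have : i ∈ S ∩ D := Finset.mem_inter.2 ⟨hi.1, hD⟩
        rw [hSD] at this
        simp at this
    obtain ⟨_, ⟨M, hMc, hME, rfl⟩, hMa⟩ := pack_mono hPack hg
    have key : ∀ M : Multiset (Finset (Fin n)), (∀ S ∈ M, S ∈ E) → (M.map indS).sum ≤ a →
        ∃ N : Finset (Finset (Fin n)), N ⊆ F ∧ N.card = M.card ∧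
          (∀ S ∈ N, ∀ T ∈ N, S ≠ T → Disjoint S T) ∧
          ∀ T ∈ N, ∀ i ∈ T, i ∉ C ∧ 1 ≤ (M.map indS).sum i := by
      intro M
      induction M using Multiset.induction_on with
      | empty => intro _ _; exact ⟨∅, by simp⟩
      | cons S M ih =>
        intro hE hle
        rw [Multiset.map_cons, Multiset.sum_cons] at hle
        obtain ⟨N, hNF, hNc, hNd, hN1⟩ := ih (fun T hT => hE T (Multiset.mem_cons_of_mem hT))
          (le_trans le_add_self hle)
        have hle' : ∀ i ∈ S, 1 + (M.map indS).sum i ≤ a i := by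
          intro i hi
          have := hle i
          rwa [Finsupp.add_apply, indS_apply, if_pos hi] at this
        have hSD : S ∩ D = ∅ := by
          rw [Finset.eq_empty_iff_forall_notMem]
          intro i hi
          rw [Finset.mem_inter] at hi
          have := hle' i hi.1
          rw [ha, if_pos hi.2] at this
          omega
        obtain ⟨T, hTF, hTS⟩ := hFex S (hE S (Multiset.mem_cons_self _ _)) hSD
        have hdis : ∀ T' ∈ N, Disjoint T T' := by
          intro T' hT'
          rw [Finset.disjoint_left]
          intro i hi hi'
          obtain ⟨hC, h1⟩ := hN1 T' hT' i hi'
          have := hle' i (Finset.mem_sdiff.1 (hTS hi)).1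
          rw [ha, if_neg hC] at this
          split_ifs at this <;> omega
        have hTN : T ∉ N := by
          intro h
          have := hdis T h
          rw [disjoint_self] at this
          exact (hFne T hTF).ne_empty this
        refine ⟨insert T N, Finset.insert_subset hTF hNF, ?_, ?_, ?_⟩
        · rw [Finset.card_insert_of_notMem hTN, hNc, Multiset.card_cons]
        · intro U hU V hV hUV
          rcases Finset.mem_insert.1 hU with rfl | hU2 <;>
            rcases Finset.mem_insert.1 hV with rfl | hV2
          · exact absurd rfl hUV
          · exact hdis V hV2
          · exact (hdis U hU2).symm
          · exact hNd U hU2 V hV2 hUV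
        · intro U hU i hi
          rw [Multiset.map_cons, Multiset.sum_cons, Finsupp.add_apply]
          rcases Finset.mem_insert.1 hU with rfl | hU
          · have := Finset.mem_sdiff.1 (hTS hi)
            refine ⟨this.2, ?_⟩
            rw [indS_apply, if_pos this.1]; omega
          · have := hN1 U hU i hi
            exact ⟨this.1, by omega⟩
    obtain ⟨N, hNF, hNc, hNd, -⟩ := key M hME hMa
    exact ⟨N, hNF, hNc.trans hMc, hNd⟩
  · rw [hbeta]
    exact csSup_le ⟨0, ∅, by simp⟩ hB
end

section
/- Let 𝒞 be a clutter with incidence matrix A having columns v_1,…,v_q ∈ {0,1}^n, and let C_1,…,C_s be the minimal vertex covers of 𝒞 (equivalently, the supports of the minimal primes of the edge ideal I(𝒞)). Set ℓ_k = (Σ_{x_i ∈ C_k} e_i, −1) ∈ ℝ^{n+1} for k = 1,…,s. Then the set covering polyhedron Q(A) is integral if and only if ℝ_+𝒜′ = H_{e_1}^+ ∩ ⋯ ∩ H_{e_{n+1}}^+ ∩ H_{ℓ_1}^+ ∩ ⋯ ∩ H_{ℓ_s}^+. -/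
open Finset

/-- `C` is a minimal vertex cover of the clutter with edges `E`: every edge meets `C`, and `C`
is minimal with respect to this property. -/
def IsMinVertexCover {n q : ℕ} (E : Fin q → Finset (Fin n)) (C : Finset (Fin n)) : Prop :=
  (∀ j, (E j ∩ C).Nonempty) ∧ ∀ C' ⊆ C, (∀ j, (E j ∩ C').Nonempty) → C' = C


open scoped Pointwise in
lemma aux_farkas {n : ℕ} {ι : Type} [Fintype ι] [Nonempty ι] (w : ι → Fin n → ℝ) (x : Fin n → ℝ) :
    (∃ b : ι → ℝ, (∀ k, 0 ≤ b k) ∧ ∑ k, b k = 1 ∧ ∀ i, ∑ k, b k * w k i ≤ x i) ∨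
    ∃ α : Fin n → ℝ, (∀ i, 0 ≤ α i) ∧ ∀ k, ∑ i, α i * x i < ∑ i, α i * w k i := by
  classical
  let T : (ι → ℝ) →ₗ[ℝ] (Fin n → ℝ) := Fintype.linearCombination ℝ w
  have hT : ∀ b i, T b i = ∑ k, b k * w k i := by
    intro b i
    simp [T, Fintype.linearCombination_apply, Finset.sum_apply]
  let S : Set (Fin n → ℝ) := T '' (stdSimplex ℝ ι) + Set.Ici (0 : Fin n → ℝ)
  by_cases hx : x ∈ S
  · left
    obtain ⟨_, ⟨b, hb, rfl⟩, a, ha, rfl⟩ := Set.mem_add.1 hx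
    refine ⟨b, hb.1, hb.2, fun i => ?_⟩
    have := (show (0 : Fin n → ℝ) ≤ a from ha) i
    simp only [Pi.add_apply, hT, Pi.zero_apply] at *
    linarith
  · right
    have hconv : Convex ℝ S := ((convex_stdSimplex ℝ ι).linear_image T).add (convex_Ici 0)
    have hclosed : IsClosed S :=
      isClosed_Ici.add_left_of_isCompact
        ((isCompact_stdSimplex ℝ ι).image T.continuous_of_finiteDimensional)
    obtain ⟨f, u, hfx, hfS⟩ := geometric_hahn_banach_point_closed hconv hclosed hx
    have hf : ∀ z : Fin n → ℝ, f z = ∑ i, f (Pi.single i 1) * z i := by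
      intro z
      conv_lhs => rw [pi_eq_sum_univ' z, map_sum]
      refine Finset.sum_congr rfl fun i _ => ?_
      rw [map_smul, smul_eq_mul, mul_comm]
    have hw : ∀ k, ∀ a : Fin n → ℝ, 0 ≤ a → w k + a ∈ S := by
      intro k a ha
      refine Set.add_mem_add ⟨Pi.single k 1, single_mem_stdSimplex ℝ k, ?_⟩ ha
      simp [T]
    refine ⟨fun i => f (Pi.single i 1), fun i => ?_, fun k => ?_⟩
    · by_contra! hneg
      obtain ⟨k⟩ := ‹Nonempty ι›
      obtain ⟨N, hN⟩ := exists_nat_gt ((f (w k) - u) / (-f (Pi.single i 1)))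
      rw [div_lt_iff₀ (by linarith)] at hN
      have h1 := hfS _ (hw k ((N : ℝ) • Pi.single i 1)
        (smul_nonneg (Nat.cast_nonneg N) (Pi.single_nonneg.2 zero_le_one)))
      rw [map_add, map_smul, smul_eq_mul] at h1
      linarith
    · have h1 := hfS _ (hw k 0 le_rfl)
      rw [add_zero] at h1
      rw [← hf, ← hf]
      linarith

lemma aux_convex {n q : ℕ} (v : Fin q → Fin n → ℝ) : Convex ℝ (coveringPolyhedron v) := by
  intro x hx y hy a b ha hb hab
  refine ⟨fun i => ?_, fun j => ?_⟩
  · have := hx.1 i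
    have := hy.1 i
    simp only [Pi.add_apply, Pi.smul_apply, smul_eq_mul]
    positivity
  · have h1 := mul_le_mul_of_nonneg_left (hx.2 j) ha
    have h2 := mul_le_mul_of_nonneg_left (hy.2 j) hb
    have : ∑ i, (a • x + b • y) i * v j i = a * ∑ i, x i * v j i + b * ∑ i, y i * v j i := by
      rw [Finset.mul_sum, Finset.mul_sum, ← Finset.sum_add_distrib]
      refine Finset.sum_congr rfl fun i _ => ?_
      simp only [Pi.add_apply, Pi.smul_apply, smul_eq_mul]
      ring
    linarith

lemma aux_closed {n q : ℕ} (v : Fin q → Fin n → ℝ) : IsClosed (coveringPolyhedron v) := by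
  have : coveringPolyhedron v = (⋂ i, {x | 0 ≤ x i}) ∩ ⋂ j, {x | 1 ≤ ∑ i, x i * v j i} := by
    ext x; simp [coveringPolyhedron]
  rw [this]
  refine (isClosed_iInter fun i => ?_).inter (isClosed_iInter fun j => ?_)
  · exact isClosed_le (by fun_prop) (by fun_prop)
  · exact isClosed_le (by fun_prop) (by fun_prop)

lemma aux_extreme {n q : ℕ} (v : Fin q → Fin n → ℝ) (α : Fin n → ℝ) (hα : ∀ i, 0 < α i)
    (y : Fin n → ℝ) (hy : y ∈ coveringPolyhedron v) :
    ∃ x ∈ Set.extremePoints ℝ (coveringPolyhedron v), ∑ i, α i * x i ≤ ∑ i, α i * y i := by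
  let Q := coveringPolyhedron v
  let l : (Fin n → ℝ) →L[ℝ] ℝ := ∑ i, α i • ContinuousLinearMap.proj i
  have hl : ∀ z, l z = ∑ i, α i * z i := by
    intro z; simp [l]
  let K : Set (Fin n → ℝ) := {x ∈ Q | l x ≤ l y}
  have hKcl : IsClosed K := (aux_closed v).inter (isClosed_le l.continuous continuous_const)
  have hK : IsCompact K := by
    refine (isCompact_Icc (a := (0 : Fin n → ℝ)) (b := fun i => l y / α i)).of_isClosed_subset
      hKcl ?_
    rintro x ⟨hx, hxy⟩
    refine ⟨fun i => hx.1 i, fun i => ?_⟩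
    rw [le_div_iff₀ (hα i), mul_comm]
    refine le_trans ?_ hxy
    rw [hl]
    exact Finset.single_le_sum (f := fun i => α i * x i)
      (fun i _ => mul_nonneg (hα i).le (hx.1 i)) (Finset.mem_univ i)
  obtain ⟨m, hmK, hm⟩ := hK.exists_isMinOn ⟨y, hy, le_rfl⟩ l.continuous.continuousOn
  have hmQ : ∀ z ∈ Q, l m ≤ l z := by
    intro z hz
    rcases le_total (l z) (l y) with h | h
    · exact hm ⟨hz, h⟩
    · exact hmK.2.trans h
  let F : Set (Fin n → ℝ) := {x ∈ Q | ∀ z ∈ Q, (-l) z ≤ (-l) x}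
  have hF : IsExposed ℝ Q F := fun _ => ⟨-l, rfl⟩
  have hFm : m ∈ F := ⟨hmK.1, fun z hz => by
    have := hmQ z hz
    simpa using this⟩
  have hFK : F ⊆ K := fun x hx => ⟨hx.1, by
    have := hx.2 y hy
    simpa using this⟩
  have hFc : IsCompact F := hK.of_isClosed_subset (hF.isClosed (aux_closed v)) hFK
  obtain ⟨x, hx⟩ := hFc.extremePoints_nonempty ⟨m, hFm⟩
  refine ⟨x, hF.isExtreme.extremePoints_subset_extremePoints hx, ?_⟩
  have := (hFK hx.1).2
  rwa [hl, hl] at this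

lemma aux_cover {n q : ℕ} (E : Fin q → Finset (Fin n)) (C : Finset (Fin n))
    (hC : ∀ j, (E j ∩ C).Nonempty) : ∃ D ⊆ C, IsMinVertexCover E D := by
  obtain ⟨D, hD, hm⟩ := (Set.toFinite {C : Finset (Fin n) | ∀ j, (E j ∩ C).Nonempty}).exists_le_minimal
    (show C ∈ {C : Finset (Fin n) | ∀ j, (E j ∩ C).Nonempty} from hC)
  exact ⟨D, hD, hm.1, fun C' h h' => Finset.Subset.antisymm h (hm.2 h' h)⟩

lemma aux_ell {n : ℕ} (x : Fin (n + 1) → ℝ) (C : Finset (Fin n)) :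
    ∑ k, x k * (Fin.snoc (fun i => if i ∈ C then (1 : ℝ) else 0) (-1) : Fin (n + 1) → ℝ) k =
      ∑ i, x (Fin.castSucc i) * (if i ∈ C then 1 else 0) - x (Fin.last n) := by
  rw [Fin.sum_univ_castSucc]
  simp only [Fin.snoc_castSucc, Fin.snoc_last]
  ring

lemma aux_rees_s11 {n q : ℕ} (v : Fin q → Fin n → ℝ) (x : Fin (n + 1) → ℝ) :
    x ∈ reesCone v ↔ ∃ b : Fin q → ℝ, (∀ j, 0 ≤ b j) ∧ x (Fin.last n) = ∑ j, b j ∧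
      ∀ i, ∑ j, b j * v j i ≤ x (Fin.castSucc i) := by
  have h1 : ∀ (a : Fin n → ℝ) (i : Fin n),
      (∑ k, a k • (Pi.single (Fin.castSucc k) 1 : Fin (n + 1) → ℝ)) (Fin.castSucc i) = a i := by
    intro a i
    simp [Finset.sum_apply, Pi.single_apply]
  have h2 : ∀ (a : Fin n → ℝ),
      (∑ k, a k • (Pi.single (Fin.castSucc k) 1 : Fin (n + 1) → ℝ)) (Fin.last n) = 0 := by
    intro a
    rw [Finset.sum_apply]
    refine Finset.sum_eq_zero fun k _ => ?_
    simp [Pi.single_apply, (Fin.castSucc_lt_last k).ne']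
  have h3 : ∀ (b : Fin q → ℝ) (i : Fin n),
      (∑ j, b j • (Fin.snoc (v j) 1 : Fin (n + 1) → ℝ)) (Fin.castSucc i) = ∑ j, b j * v j i := by
    intro b i
    simp [Finset.sum_apply]
  have h4 : ∀ (b : Fin q → ℝ),
      (∑ j, b j • (Fin.snoc (v j) 1 : Fin (n + 1) → ℝ)) (Fin.last n) = ∑ j, b j := by
    intro b
    simp [Finset.sum_apply]
  constructor
  · rintro ⟨a, b, ha, hb, rfl⟩
    refine ⟨b, hb, ?_, fun i => ?_⟩
    · rw [Pi.add_apply, h2, h4, zero_add]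
    · rw [Pi.add_apply, h1, h3]
      linarith [ha i]
  · rintro ⟨b, hb, hl, hi⟩
    refine ⟨fun i => x (Fin.castSucc i) - ∑ j, b j * v j i, b, fun i => sub_nonneg.2 (hi i), hb, ?_⟩
    ext k
    refine Fin.lastCases ?_ (fun i => ?_) k
    · rw [Pi.add_apply, h2, h4, zero_add, hl]
    · rw [Pi.add_apply, h1, h3]
      ring

lemma aux_coverQ {n q : ℕ} (E : Fin q → Finset (Fin n)) (C : Finset (Fin n))
    (hC : ∀ j, (E j ∩ C).Nonempty) :
    (fun i => if i ∈ C then (1 : ℝ) else 0) ∈ coveringPolyhedron (incidence E) := by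
  refine ⟨fun i => ?_, fun j => ?_⟩
  · dsimp only
    split_ifs <;> norm_num
  · obtain ⟨i, hi⟩ := hC j
    rw [Finset.mem_inter] at hi
    have h := Finset.single_le_sum
      (f := fun i => (if i ∈ C then (1 : ℝ) else 0) * incidence E j i)
      (fun i _ => by dsimp only [incidence]; split_ifs <;> norm_num) (Finset.mem_univ i)
    simpa [incidence, hi.1, hi.2] using h

lemma aux_sub {n q : ℕ} (v : Fin q → Fin n → ℝ) (b : Fin q → ℝ) (hb : ∀ j, 0 ≤ b j)
    (α : Fin n → ℝ) (hα : ∀ i, ∑ j, b j * v j i ≤ α i) (x : Fin n → ℝ)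
    (hx : x ∈ coveringPolyhedron v) : ∑ j, b j ≤ ∑ i, α i * x i := by
  calc ∑ j, b j ≤ ∑ j, b j * ∑ i, x i * v j i :=
        Finset.sum_le_sum fun j _ => le_mul_of_one_le_right (hb j) (hx.2 j)
    _ = ∑ i, (∑ j, b j * v j i) * x i := by
        simp only [Finset.mul_sum, Finset.sum_mul]
        rw [Finset.sum_comm]
        refine Finset.sum_congr rfl fun i _ => Finset.sum_congr rfl fun j _ => by ring
    _ ≤ ∑ i, α i * x i :=
        Finset.sum_le_sum fun i _ => mul_le_mul_of_nonneg_right (hα i) (hx.1 i)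

/-- Let `𝒞` be a clutter with incidence matrix `A` and minimal vertex covers `C₁, …, C_s`, and
let `ℓ_k = (Σ_{x_i ∈ C_k} e_i, -1)`.  Then `Q(A)` is integral if and only if
`ℝ₊𝒜′ = H⁺_{e₁} ∩ ⋯ ∩ H⁺_{e_{n+1}} ∩ H⁺_{ℓ₁} ∩ ⋯ ∩ H⁺_{ℓ_s}`. -/
theorem stmt11 {n q : ℕ} (E : Fin q → Finset (Fin n)) (hE : IsClutter E) :
    IntegralPolyhedron (incidence E) ↔
      reesCone (incidence E) =
        {x | ∀ i, 0 ≤ x i} ∩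
        {x | ∀ C : Finset (Fin n), IsMinVertexCover E C →
          0 ≤ ∑ k, x k *
            (Fin.snoc (fun i => if i ∈ C then (1 : ℝ) else 0) (-1) : Fin (n + 1) → ℝ) k} := by
  classical
  have hsub : reesCone (incidence E) ⊆ {x | ∀ i, 0 ≤ x i} ∩
        {x | ∀ C : Finset (Fin n), IsMinVertexCover E C →
          0 ≤ ∑ k, x k *
            (Fin.snoc (fun i => if i ∈ C then (1 : ℝ) else 0) (-1) : Fin (n + 1) → ℝ) k} := by
    intro x hx
    obtain ⟨b, hb, hl, hi⟩ := (aux_rees_s11 _ _).1 hx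
    refine ⟨fun k => ?_, fun C hC => ?_⟩
    · refine Fin.lastCases ?_ (fun i => ?_) k
      · rw [hl]; exact Finset.sum_nonneg fun j _ => hb j
      · refine le_trans (Finset.sum_nonneg fun j _ => mul_nonneg (hb j) ?_) (hi i)
        dsimp only [incidence]
        split_ifs <;> norm_num
    · rw [aux_ell, hl, sub_nonneg]
      exact aux_sub _ b hb _ hi _ (aux_coverQ E C hC.1)
  constructor
  · intro hint
    refine Set.Subset.antisymm hsub ?_
    rintro x ⟨hx0, hxC⟩
    have hx0 : ∀ i, 0 ≤ x i := hx0
    have hxC : ∀ C : Finset (Fin n), IsMinVertexCover E C →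
        x (Fin.last n) ≤ ∑ i, x (Fin.castSucc i) * (if i ∈ C then 1 else 0) := by
      intro C hC
      have := hxC C hC
      rwa [aux_ell, sub_nonneg] at this
    rw [aux_rees_s11]
    rcases (hx0 (Fin.last n)).eq_or_lt with ht | ht
    · exact ⟨0, fun _ => le_rfl, by simp [← ht], fun i => by simpa using hx0 _⟩
    set t := x (Fin.last n) with ht_def
    rcases Nat.eq_zero_or_pos q with rfl | hq
    · exfalso
      have := hxC ∅ ⟨fun j => j.elim0, fun C' h _ => Finset.subset_empty.1 h⟩
      simp at this
      linarith
    haveI : Nonempty (Fin q) := ⟨⟨0, hq⟩⟩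
    rcases aux_farkas (incidence E) (fun i => x (Fin.castSucc i) / t) with
      ⟨b, hb, hb1, hbi⟩ | ⟨y, hy, hyv⟩
    · refine ⟨fun j => t * b j, fun j => mul_nonneg ht.le (hb j), ?_, fun i => ?_⟩
      · rw [← Finset.mul_sum, hb1, mul_one]
      · have := hbi i
        rw [le_div_iff₀ ht, Finset.sum_mul] at this
        refine le_trans (le_of_eq ?_) this
        exact Finset.sum_congr rfl fun j _ => by ring
    · exfalso
      obtain ⟨j0, hj0⟩ := Finite.exists_min (fun j => ∑ i, y i * incidence E j i)
      set m := ∑ i, y i * incidence E j0 i with hm_def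
      have hs : ∑ i, y i * (x (Fin.castSucc i) / t) < m := hyv j0
      have hm : 0 < m := lt_of_le_of_lt
        (Finset.sum_nonneg fun i _ => mul_nonneg (hy i) (div_nonneg (hx0 _) ht.le)) hs
      let z : Fin n → ℝ := fun i => y i / m
      have hz : z ∈ coveringPolyhedron (incidence E) := by
        refine ⟨fun i => div_nonneg (hy i) hm.le, fun j => ?_⟩
        have : ∑ i, z i * incidence E j i = (∑ i, y i * incidence E j i) / m := by
          rw [Finset.sum_div]
          exact Finset.sum_congr rfl fun i _ => by simp only [z]; ring
        rw [this, le_div_iff₀ hm, one_mul]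
        exact hj0 j
      have hzt : ∑ i, x (Fin.castSucc i) * z i < t := by
        have : ∑ i, x (Fin.castSucc i) * z i = (∑ i, y i * (x (Fin.castSucc i) / t)) * (t / m) := by
          rw [Finset.sum_mul]
          exact Finset.sum_congr rfl fun i _ => by simp only [z]; field_simp
        rw [this, ← mul_div_assoc, div_lt_iff₀ hm, mul_comm]
        exact mul_lt_mul_of_pos_left hs ht
      set S := ∑ i, z i with hS
      have hS0 : 0 ≤ S := Finset.sum_nonneg fun i _ => hz.1 i
      obtain ⟨ε, hε, hεt⟩ : ∃ ε : ℝ, 0 < ε ∧ ∑ i, x (Fin.castSucc i) * z i + ε * S < t := by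
        refine ⟨(t - ∑ i, x (Fin.castSucc i) * z i) / (S + 1), div_pos (by linarith) (by linarith), ?_⟩
        rw [div_mul_eq_mul_div, ← lt_sub_iff_add_lt', div_lt_iff₀ (by linarith)]
        exact mul_lt_mul_of_pos_left (by linarith) (by linarith)
      obtain ⟨p, hp, hpz⟩ := aux_extreme (incidence E) (fun i => x (Fin.castSucc i) + ε)
        (fun i => add_pos_of_nonneg_of_pos (hx0 _) hε) z hz
      have hpQ : p ∈ coveringPolyhedron (incidence E) := hp.1
      have hpi := hint p hp
      have hzz : ∑ i, (x (Fin.castSucc i) + ε) * z i < t := by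
        simp only [add_mul, Finset.sum_add_distrib, ← Finset.mul_sum]
        exact hεt
      obtain ⟨D, hD, hDm⟩ := aux_cover E (Finset.univ.filter fun i => 0 < p i) (by
        intro j
        have h1 : 0 < ∑ i, p i * incidence E j i := lt_of_lt_of_le one_pos (hpQ.2 j)
        obtain ⟨i, _, hi⟩ := Finset.exists_lt_of_sum_lt (s := Finset.univ)
          (f := fun _ : Fin n => (0 : ℝ)) (by simpa using h1)
        refine ⟨i, ?_⟩
        by_cases hiE : i ∈ E j
        · simpa [incidence, hiE] using hi
        · simp [incidence, hiE] at hi)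
      have hle : ∑ i, x (Fin.castSucc i) * (if i ∈ D then 1 else 0) ≤
          ∑ i, (x (Fin.castSucc i) + ε) * p i := by
        refine Finset.sum_le_sum fun i _ => ?_
        have hpi0 := hpQ.1 i
        have hxi := hx0 (Fin.castSucc i)
        split_ifs with hiD
        · have hpos : 0 < p i := by simpa using hD hiD
          obtain ⟨k, hk⟩ := hpi i
          have hk1 : (1 : ℝ) ≤ p i := by
            rw [hk] at hpos ⊢
            exact_mod_cast hpos
          nlinarith
        · rw [mul_zero]
          positivity
      have := hxC D hDm
      linarith
  · intro heq p hp
    have hpQ : p ∈ coveringPolyhedron (incidence E) := hp.1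
    let ι := {C : Finset (Fin n) // IsMinVertexCover E C}
    let w : ι → Fin n → ℝ := fun C i => if i ∈ C.1 then 1 else 0
    haveI : Nonempty ι := by
      obtain ⟨D, _, hD⟩ := aux_cover E Finset.univ (by simpa using hE.1)
      exact ⟨⟨D, hD⟩⟩
    have hwQ : ∀ C, w C ∈ coveringPolyhedron (incidence E) := fun C => aux_coverQ E C.1 C.2.1
    rcases aux_farkas w p with ⟨b, hb, hb1, hbi⟩ | ⟨α, hα, hαw⟩
    · let c : Fin n → ℝ := ∑ k, b k • w k
      have hc : ∀ i, c i = ∑ k, b k * w k i := fun i => by simp [c, Finset.sum_apply]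
      have hcH : c ∈ convexHull ℝ (Set.range w) :=
        (convex_convexHull ℝ _).sum_mem (fun k _ => hb k) hb1
          (fun k _ => subset_convexHull ℝ _ ⟨k, rfl⟩)
      have hHQ : convexHull ℝ (Set.range w) ⊆ coveringPolyhedron (incidence E) :=
        convexHull_min (by rintro _ ⟨C, rfl⟩; exact hwQ C) (aux_convex _)
      have hcQ := hHQ hcH
      let d : Fin n → ℝ := p + (p - c)
      have hd : d ∈ coveringPolyhedron (incidence E) := by
        have hpd : ∀ i, p i ≤ d i := fun i => by
          have := hbi i
          rw [← hc] at this
          simp only [d, Pi.add_apply, Pi.sub_apply]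
          linarith
        refine ⟨fun i => (hpQ.1 i).trans (hpd i), fun j => (hpQ.2 j).trans ?_⟩
        refine Finset.sum_le_sum fun i _ => mul_le_mul_of_nonneg_right (hpd i) ?_
        dsimp only [incidence]
        split_ifs <;> norm_num
      have hcp : c = p := by
        refine hp.2 hcQ hd ⟨1/2, 1/2, by norm_num, by norm_num, by norm_num, ?_⟩
        ext i
        simp only [d, Pi.add_apply, Pi.sub_apply, Pi.smul_apply, smul_eq_mul]
        ring
      have hpH : p ∈ Set.extremePoints ℝ (convexHull ℝ (Set.range w)) :=
        inter_extremePoints_subset_extremePoints_of_subset hHQ ⟨hcp ▸ hcH, hp⟩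
      obtain ⟨C, rfl⟩ := extremePoints_convexHull_subset hpH
      intro i
      by_cases h : i ∈ C.1
      · exact ⟨1, by simp [w, h]⟩
      · exact ⟨0, by simp [w, h]⟩
    · exfalso
      obtain ⟨C0, hC0⟩ := Finite.exists_min (fun C => ∑ i, α i * w C i)
      have hmem : (Fin.snoc α (∑ i, α i * w C0 i) : Fin (n + 1) → ℝ) ∈ reesCone (incidence E) := by
        rw [heq]
        refine ⟨fun k => ?_, fun C hC => ?_⟩
        · refine Fin.lastCases ?_ (fun i => ?_) k
          · rw [Fin.snoc_last]
            exact Finset.sum_nonneg fun i _ => mul_nonneg (hα i) ((hwQ C0).1 i)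
          · rw [Fin.snoc_castSucc]
            exact hα i
        · rw [aux_ell, sub_nonneg]
          simp only [Fin.snoc_castSucc, Fin.snoc_last]
          exact hC0 ⟨C, hC⟩
      obtain ⟨b, hb, hl, hi⟩ := (aux_rees_s11 _ _).1 hmem
      simp only [Fin.snoc_castSucc, Fin.snoc_last] at hl hi
      have h1 := aux_sub _ b hb α hi p hpQ
      have h2 := hαw C0
      linarith
end

section
/- Let 𝒞 be a clutter and let I = I(𝒞) ⊆ R = K[x_1,…,x_n] be its edge ideal with minimal primes 𝔭_1,…,𝔭_s. Then 𝒞 has the max-flow min-cut property if and only if I is normally torsion free, i.e., I^i = I^{(i)} for all i ≥ 1, where I^{(i)} = 𝔭_1^i ∩ ⋯ ∩ 𝔭_s^i is the i-th symbolic power of I. -/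
open Finset

/-- The `i`-th symbolic power `I^{(i)} = 𝔭₁ⁱ ∩ ⋯ ∩ 𝔭_sⁱ` of an ideal `I` with minimal primes
`𝔭₁, …, 𝔭_s`. -/
def symbolicPower {R : Type*} [CommRing R] (I : Ideal R) (i : ℕ) : Ideal R :=
  ⨅ p ∈ I.minimalPrimes, p ^ i


open MvPolynomial in
lemma aux_pow_le {σ ι R : Type*} [Fintype ι] [CommRing R] (v : ι → σ →₀ ℕ) (k : ℕ) :
    (Ideal.span (Set.range fun j => monomial (v j) (1 : R))) ^ k ≤
      Ideal.span ((fun s => monomial s (1 : R)) ''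
        {s | ∃ b : ι → ℕ, ∑ j, b j = k ∧ s = ∑ j, b j • v j}) := by
  classical
  induction k with
  | zero =>
    have : (1 : MvPolynomial σ R) ∈ Ideal.span ((fun s => monomial s (1 : R)) ''
        {s | ∃ b : ι → ℕ, ∑ j, b j = 0 ∧ s = ∑ j, b j • v j}) :=
      Ideal.subset_span ⟨0, ⟨0, by simp, by simp⟩, rfl⟩
    rw [(Ideal.eq_top_iff_one _).2 this]
    exact le_top
  | succ k ih =>
    rw [pow_succ]
    refine (Ideal.mul_mono_left ih).trans ?_
    rw [Ideal.span_mul_span', Ideal.span_le]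
    rintro _ ⟨_, ⟨_, ⟨b, hb, rfl⟩, rfl⟩, _, ⟨j, rfl⟩, rfl⟩
    refine Ideal.subset_span ⟨∑ i, (b i + (Pi.single j 1 : ι → ℕ) i) • v i, ⟨fun i => b i + (Pi.single j 1 : ι → ℕ) i, ?_, rfl⟩, ?_⟩
    · simp [Finset.sum_add_distrib, hb]
    · simp only [monomial_mul, mul_one]
      congr 1
      simp [add_smul, Finset.sum_add_distrib, Pi.single_apply, ite_smul]

open MvPolynomial in
lemma aux_mem_pow {σ ι R : Type*} [Fintype ι] [CommRing R] (v : ι → σ →₀ ℕ) (k : ℕ)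
    {f : MvPolynomial σ R}
    (hf : f ∈ (Ideal.span (Set.range fun j => monomial (v j) (1 : R))) ^ k)
    (m : σ →₀ ℕ) (hm : m ∈ f.support) :
    ∃ b : ι → ℕ, ∑ j, b j = k ∧ ∑ j, b j • v j ≤ m := by
  obtain ⟨s, ⟨b, hb, rfl⟩, h⟩ := mem_ideal_span_monomial_image.1 (aux_pow_le v k hf) m hm
  exact ⟨b, hb, h⟩

open MvPolynomial in
lemma aux_mem_pow_of {σ ι R : Type*} [Fintype ι] [CommRing R] (v : ι → σ →₀ ℕ) (k : ℕ)
    (m : σ →₀ ℕ) (r : R) (J : Ideal (MvPolynomial σ R)) (hJ : ∀ j, monomial (v j) (1 : R) ∈ J)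
    (b : ι → ℕ) (hk : k ≤ ∑ j, b j) (h : ∑ j, b j • v j ≤ m) :
    monomial m r ∈ J ^ k := by
  refine Ideal.pow_le_pow_right hk ?_
  have h1 : ∏ j, (monomial (v j) (1 : R)) ^ b j ∈ J ^ (∑ j, b j) := by
    rw [← Finset.prod_pow_eq_pow_sum]
    exact Ideal.prod_mem_prod fun j _ => Ideal.pow_mem_pow (hJ j) _
  have h2 : ∏ j, (monomial (v j) (1 : R)) ^ b j = monomial (∑ j, b j • v j) (1 : R) := by
    simp only [monomial_pow, one_pow]
    rw [← monomial_sum_one]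
  rw [h2] at h1
  obtain ⟨c, rfl⟩ := le_iff_exists_add.1 h
  have h3 := Ideal.mul_mem_right (monomial c r) _ h1
  simpa [monomial_mul] using h3

open MvPolynomial in
lemma aux_prime {σ K : Type*} [Field K] (C : Set σ) :
    (Ideal.span (X '' C : Set (MvPolynomial σ K))).IsPrime := by
  classical
  let φ : MvPolynomial σ K →ₐ[K] MvPolynomial σ K := aeval fun i => if i ∈ C then 0 else X i
  have : Ideal.span (X '' C : Set (MvPolynomial σ K)) = RingHom.ker φ := by
    apply le_antisymm
    · rw [Ideal.span_le]
      rintro _ ⟨i, hi, rfl⟩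
      simp [φ, RingHom.mem_ker, hi]
    · intro f hf
      have h : (Ideal.Quotient.mkₐ K (Ideal.span (X '' C : Set (MvPolynomial σ K)))).comp φ
          = Ideal.Quotient.mkₐ K (Ideal.span (X '' C : Set (MvPolynomial σ K))) := by
        apply MvPolynomial.algHom_ext
        intro i
        by_cases hi : i ∈ C
        · simp only [φ, AlgHom.comp_apply, aeval_X, hi, if_true, map_zero]
          symm
          exact Ideal.Quotient.eq_zero_iff_mem.2 (Ideal.subset_span ⟨i, hi, rfl⟩)
        · simp [φ, hi]
      have h2 := DFunLike.congr_fun h f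
      rw [AlgHom.comp_apply, (RingHom.mem_ker).1 hf, map_zero] at h2
      exact Ideal.Quotient.eq_zero_iff_mem.1 h2.symm
  rw [this]
  exact RingHom.ker_isPrime φ

/-- combinatorial form: integer packing number is at least the covering number -/
def CombP {n q : ℕ} (E : Fin q → Finset (Fin n)) : Prop :=
  ∀ (α : Fin n → ℕ) (k : ℕ),
    (∀ C : Finset (Fin n), (∀ j, ∃ i ∈ C, i ∈ E j) → k ≤ ∑ i ∈ C, α i) →
    ∃ b : Fin q → ℕ, k ≤ ∑ j, b j ∧ ∀ i, ∑ j, b j * (if i ∈ E j then 1 else 0) ≤ α i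

lemma aux_closed_s13 {n q : ℕ} (v : Fin q → Fin n → ℝ) (hv0 : ∀ j i, 0 ≤ v j i)
    (hv : ∀ j, ∃ i, v j i = 1) :
    IsClosed {p : (Fin n → ℝ) × ℝ | ∃ y : Fin q → ℝ, (∀ j, 0 ≤ y j) ∧
      (∀ i, ∑ j, y j * v j i ≤ p.1 i) ∧ p.2 ≤ ∑ j, y j} := by
  apply IsSeqClosed.isClosed
  intro p p0 hp hlim
  choose y hy0 hy1 hy2 using hp
  have hbd := Metric.isBounded_range_of_tendsto p hlim
  obtain ⟨M, hM⟩ := isBounded_iff_forall_norm_le.1 hbd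
  have hyM : ∀ m, y m ∈ Set.Icc (0 : Fin q → ℝ) (fun _ => M) := by
    intro m
    refine ⟨hy0 m, fun j => ?_⟩
    obtain ⟨i, hi⟩ := hv j
    have h1 : y m j * v j i ≤ ∑ j, y m j * v j i :=
      Finset.single_le_sum (f := fun j => y m j * v j i)
        (fun j _ => mul_nonneg (hy0 m j) (hv0 j i)) (Finset.mem_univ j)
    rw [hi, mul_one] at h1
    calc y m j ≤ (p m).1 i := h1.trans (hy1 m i)
      _ ≤ ‖(p m).1 i‖ := Real.le_norm_self _
      _ ≤ ‖(p m).1‖ := norm_le_pi_norm _ i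
      _ ≤ ‖p m‖ := norm_fst_le _
      _ ≤ M := hM _ ⟨m, rfl⟩
  obtain ⟨y0, hy0mem, φ, hφ, hφl⟩ := isCompact_Icc.tendsto_subseq hyM
  have hpl := hlim.comp hφ.tendsto_atTop
  have hyl : ∀ j, Filter.Tendsto (fun m => y (φ m) j) Filter.atTop (nhds (y0 j)) :=
    fun j => (tendsto_pi_nhds.1 hφl) j
  refine ⟨y0, hy0mem.1, fun i => ?_, ?_⟩
  · have h1 : Filter.Tendsto (fun m => (p (φ m)).1 i) Filter.atTop (nhds (p0.1 i)) :=
      (tendsto_pi_nhds.1 ((continuous_fst.tendsto _).comp hpl)) i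
    exact le_of_tendsto_of_tendsto' (tendsto_finsetSum _ fun j _ => (hyl j).mul_const _) h1
      fun m => hy1 _ i
  · have h1 : Filter.Tendsto (fun m => (p (φ m)).2) Filter.atTop (nhds (p0.2)) :=
      ((continuous_snd.tendsto _).comp hpl)
    exact le_of_tendsto_of_tendsto' h1 (tendsto_finsetSum _ fun j _ => hyl j)
      fun m => hy2 _

lemma aux_duality {n q : ℕ} (v : Fin q → Fin n → ℝ) (hv0 : ∀ j i, 0 ≤ v j i)
    (hv : ∀ j, ∃ i, v j i = 1) (α : Fin n → ℝ) (hα : ∀ i, 0 ≤ α i) (k : ℝ)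
    (h : ∀ x : Fin n → ℝ, (∀ i, 0 ≤ x i) → (∀ j, 1 ≤ ∑ i, x i * v j i) → k ≤ ∑ i, α i * x i) :
    ∃ y : Fin q → ℝ, (∀ j, 0 ≤ y j) ∧ (∀ i, ∑ j, y j * v j i ≤ α i) ∧ k ≤ ∑ j, y j := by
  classical
  let D : ProperCone ℝ ((Fin n → ℝ) × ℝ) :=
    { carrier := {p : (Fin n → ℝ) × ℝ | ∃ y : Fin q → ℝ, (∀ j, 0 ≤ y j) ∧
        (∀ i, ∑ j, y j * v j i ≤ p.1 i) ∧ p.2 ≤ ∑ j, y j}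
      add_mem' := by
        rintro p p' ⟨y, h0, h1, h2⟩ ⟨y', h0', h1', h2'⟩
        refine ⟨y + y', fun j => add_nonneg (h0 j) (h0' j), fun i => ?_, ?_⟩
        · simp only [Pi.add_apply, add_mul, Finset.sum_add_distrib, Prod.fst_add]
          exact add_le_add (h1 i) (h1' i)
        · simp only [Pi.add_apply, Finset.sum_add_distrib, Prod.snd_add]
          exact add_le_add h2 h2'
      zero_mem' := ⟨0, by simp, by simp, by simp⟩
      smul_mem' := by
        rintro ⟨c, hc⟩ p ⟨y, h0, h1, h2⟩
        refine ⟨c • y, fun j => mul_nonneg hc (h0 j), fun i => ?_, ?_⟩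
        · simp only [Pi.smul_apply, smul_eq_mul, mul_assoc, ← Finset.mul_sum]
          exact mul_le_mul_of_nonneg_left (h1 i) hc
        · simp only [Pi.smul_apply, smul_eq_mul, ← Finset.mul_sum]
          exact mul_le_mul_of_nonneg_left h2 hc
      isClosed' := aux_closed_s13 v hv0 hv }
  by_contra hcon
  have hn : (α, k) ∉ D := fun hmem => hcon hmem
  obtain ⟨f, hf, hf0⟩ := D.hyperplane_separation_point hn
  set c : Fin n → ℝ := fun i => f (Pi.single i 1, 0) with hc
  set d : ℝ := f (0, -1) with hd
  have hfe : ∀ (γ : Fin n → ℝ) (s : ℝ), f (γ, s) = ∑ i, γ i * c i - s * d := by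
    intro γ s
    have e : ((γ, s) : (Fin n → ℝ) × ℝ) =
        ∑ i, γ i • ((Pi.single i 1, 0) : (Fin n → ℝ) × ℝ) + (-s) • (0, -1) := by
      ext i
      · simp [Prod.fst_sum, Finset.sum_apply, Pi.single_apply]
      · simp [Prod.snd_sum]
    rw [e, map_add, map_sum, map_smul]
    simp only [map_smul, smul_eq_mul, hc, hd]
    ring
  have hc0 : ∀ i, 0 ≤ c i := fun i => hf _ ⟨0, by simp, fun i' => by
    by_cases h : i' = i
    · subst h; simp
    · simp [h], by simp⟩
  have hd0 : 0 ≤ d := hf _ ⟨0, by simp, by simp, by simp⟩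
  have hvj : ∀ j, d ≤ ∑ i, c i * v j i := by
    intro j
    have := hf (v j, 1) ⟨Pi.single j 1, fun j' => by
      by_cases h : j' = j
      · subst h; simp
      · simp [h], fun i => by simp [Pi.single_apply], by simp⟩
    rw [hfe] at this
    simp only [mul_comm (c _)]
    linarith
  rw [hfe] at hf0
  rcases hd0.eq_or_lt with h0 | h0
  · rw [← h0, mul_zero, sub_zero] at hf0
    exact absurd (Finset.sum_nonneg fun i _ => mul_nonneg (hα i) (hc0 i)) (not_le.2 hf0)
  · have := h (fun i => c i / d) (fun i => div_nonneg (hc0 i) hd0) (fun j => by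
      have : ∑ i, c i / d * v j i = (∑ i, c i * v j i) / d := by
        rw [Finset.sum_div]; exact Finset.sum_congr rfl fun i _ => by ring
      rw [this, le_div_iff₀ h0, one_mul]; exact hvj j)
    have e : ∑ i, α i * (c i / d) = (∑ i, α i * c i) / d := by
      rw [Finset.sum_div]; exact Finset.sum_congr rfl fun i _ => by ring
    rw [e, le_div_iff₀ h0] at this
    linarith

lemma aux_mfmc_comb {n q : ℕ} (E : Fin q → Finset (Fin n)) (hE : ∀ j, (E j).Nonempty)
    (h : HasMFMC E) : CombP E := by
  classical
  intro α k hk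
  obtain ⟨⟨x, hxi, hx0, hx1, hxo⟩, y, hyi, hy0, hy1, hyo⟩ := h α
  have hcov : (k : ℝ) ≤ ∑ i, (α i : ℝ) * x i := by
    have hC := hk (Finset.univ.filter fun i => 1 ≤ x i) (fun j => by
      by_contra hcon
      push Not at hcon
      have hz : ∑ i, x i * incidence E j i = 0 := by
        refine Finset.sum_eq_zero fun i _ => ?_
        by_cases hij : i ∈ E j
        · have h1 : x i < 1 := by
            by_contra h2
            exact hcon i (by simpa using h2) hij
          obtain ⟨z, hz⟩ := hxi i
          have h3 := hx0 i
          rw [hz] at h1 h3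
          have h4 : z < 1 := by exact_mod_cast h1
          have h5 : 0 ≤ z := by exact_mod_cast h3
          have : z = 0 := by omega
          simp [hz, this]
        · simp [incidence, hij]
      have := hx1 j
      linarith)
    calc (k : ℝ) ≤ ((∑ i ∈ Finset.univ.filter fun i => 1 ≤ x i, α i : ℕ) : ℝ) := by exact_mod_cast hC
      _ = ∑ i ∈ Finset.univ.filter fun i => 1 ≤ x i, (α i : ℝ) := by push_cast; rfl
      _ ≤ ∑ i ∈ Finset.univ.filter fun i => 1 ≤ x i, (α i : ℝ) * x i := by
          refine Finset.sum_le_sum fun i hi => ?_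
          exact le_mul_of_one_le_right (Nat.cast_nonneg _) (Finset.mem_filter.1 hi).2
      _ ≤ _ := Finset.sum_le_sum_of_subset_of_nonneg (Finset.filter_subset _ _)
          fun i _ _ => mul_nonneg (Nat.cast_nonneg _) (hx0 i)
  obtain ⟨y', hy0', hy1', hk'⟩ := aux_duality (incidence E)
    (fun j i => by unfold incidence; split_ifs <;> norm_num)
    (fun j => by obtain ⟨i, hi⟩ := hE j; exact ⟨i, by simp [incidence, hi]⟩)
    (fun i => (α i : ℝ)) (fun i => Nat.cast_nonneg _) k
    (fun x' h0 h1 => hcov.trans (hxo x' h0 h1))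
  have hky : (k : ℝ) ≤ ∑ j, y j := hk'.trans (hyo y' hy0' hy1')
  have hb : ∀ j, ∃ b : ℕ, y j = b := by
    intro j
    obtain ⟨z, hz⟩ := hyi j
    have h3 := hy0 j
    rw [hz] at h3
    have h5 : 0 ≤ z := by exact_mod_cast h3
    obtain ⟨b, rfl⟩ := Int.eq_ofNat_of_zero_le h5
    exact ⟨b, by simpa using hz⟩
  choose b hb using hb
  refine ⟨b, ?_, fun i => ?_⟩
  · simp only [hb] at hky
    exact_mod_cast hky
  · have := hy1 i
    simp only [hb, incidence] at this
    exact_mod_cast this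

lemma aux_comb_mfmc {n q : ℕ} (E : Fin q → Finset (Fin n)) (hE : ∀ j, (E j).Nonempty)
    (h : CombP E) : HasMFMC E := by
  classical
  intro α
  obtain ⟨C, hC, hmin⟩ := Finset.exists_min_image
    ((Finset.univ : Finset (Finset (Fin n))).filter fun C => ∀ j, ∃ i ∈ C, i ∈ E j)
    (fun C => ∑ i ∈ C, α i) ⟨Finset.univ, by
      simp only [Finset.mem_filter, Finset.mem_univ, true_and]
      exact hE⟩
  simp only [Finset.mem_filter, Finset.mem_univ, true_and] at hC hmin
  obtain ⟨b, hb, hbα⟩ := h α _ hmin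
  have weak : ∀ (x : Fin n → ℝ) (y : Fin q → ℝ), (∀ i, 0 ≤ x i) →
      (∀ j, 1 ≤ ∑ i, x i * incidence E j i) → (∀ j, 0 ≤ y j) →
      (∀ i, ∑ j, y j * incidence E j i ≤ α i) → ∑ j, y j ≤ ∑ i, (α i : ℝ) * x i := by
    intro x y hx0 hx1 hy0 hy1
    calc ∑ j, y j ≤ ∑ j, y j * ∑ i, x i * incidence E j i :=
          Finset.sum_le_sum fun j _ => le_mul_of_one_le_right (hy0 j) (hx1 j)
      _ = ∑ i, (∑ j, y j * incidence E j i) * x i := by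
          simp only [Finset.mul_sum, Finset.sum_mul]
          rw [Finset.sum_comm]
          exact Finset.sum_congr rfl fun i _ => Finset.sum_congr rfl fun j _ => by ring
      _ ≤ _ := Finset.sum_le_sum fun i _ => mul_le_mul_of_nonneg_right (hy1 i) (hx0 i)
  let x : Fin n → ℝ := fun i => if i ∈ C then 1 else 0
  let y : Fin q → ℝ := fun j => b j
  have hx0 : ∀ i, 0 ≤ x i := fun i => by simp only [x]; split_ifs <;> norm_num
  have hx1 : ∀ j, 1 ≤ ∑ i, x i * incidence E j i := by
    intro j
    obtain ⟨i, hi, hij⟩ := hC j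
    have := Finset.single_le_sum (f := fun i => x i * incidence E j i)
      (fun i _ => mul_nonneg (hx0 i) (by unfold incidence; split_ifs <;> norm_num))
      (Finset.mem_univ i)
    simpa [x, incidence, hi, hij] using this
  have hy0 : ∀ j, 0 ≤ y j := fun j => Nat.cast_nonneg _
  have hy1 : ∀ i, ∑ j, y j * incidence E j i ≤ α i := by
    intro i
    have := hbα i
    simp only [y, incidence]
    exact_mod_cast this
  have key : ∑ i, (α i : ℝ) * x i ≤ ∑ j, y j := by
    have : ∑ i, (α i : ℝ) * x i = ((∑ i ∈ C, α i : ℕ) : ℝ) := by simp [x]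
    rw [this]
    simp only [y]
    exact_mod_cast hb
  refine ⟨⟨x, fun i => ?_, hx0, hx1, fun x' h0 h1 => key.trans (weak x' y h0 h1 hy0 hy1)⟩,
    y, fun j => ⟨b j, by simp [y]⟩, hy0, hy1, fun y' h0 h1 => (weak x y' hx0 hx1 h0 h1).trans key⟩
  by_cases hi : i ∈ C
  · exact ⟨1, by simp [x, hi]⟩
  · exact ⟨0, by simp [x, hi]⟩

/-- exponent vector of an edge -/
noncomputable def edgeExp {n : ℕ} (e : Finset (Fin n)) : Fin n →₀ ℕ :=
  ∑ i ∈ e, Finsupp.single i 1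

lemma edgeExp_apply {n : ℕ} (e : Finset (Fin n)) (i : Fin n) :
    edgeExp e i = if i ∈ e then 1 else 0 := by
  classical
  simp [edgeExp, Finsupp.finsetSum_apply, Finsupp.single_apply]

open MvPolynomial in
lemma edge_monomial {n : ℕ} (K : Type*) [Field K] (e : Finset (Fin n)) :
    (∏ i ∈ e, X i : MvPolynomial (Fin n) K) = monomial (edgeExp e) 1 := by
  simp [edgeExp, monomial_sum_one, X]

lemma edgeExp_le {n q : ℕ} (E : Fin q → Finset (Fin n)) (b : Fin q → ℕ) (m : Fin n →₀ ℕ) :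
    ∑ j, b j • edgeExp (E j) ≤ m ↔ ∀ i, ∑ j, b j * (if i ∈ E j then 1 else 0) ≤ m i := by
  simp only [Finsupp.le_def, Finsupp.finsetSum_apply, Finsupp.smul_apply, edgeExp_apply,
    smul_eq_mul]

/-- Let `𝒞` be a clutter and let `I = I(𝒞) ⊆ R = K[x₁, …, xₙ]` be its edge ideal.  Then `𝒞`
has the max-flow min-cut property if and only if `I` is normally torsion free, i.e.
`Iⁱ = I^{(i)}` for all `i ≥ 1`, where `I^{(i)} = 𝔭₁ⁱ ∩ ⋯ ∩ 𝔭_sⁱ` is the `i`-th symbolic power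
of `I` (`𝔭₁, …, 𝔭_s` being the minimal primes of `I`). -/
theorem stmt13 {n q : ℕ} (K : Type*) [Field K] (E : Fin q → Finset (Fin n))
    (hE : IsClutter E) (I : Ideal (MvPolynomial (Fin n) K))
    (hI : I = Ideal.span (Set.range fun j => ∏ i ∈ E j, MvPolynomial.X i)) :
    HasMFMC E ↔ ∀ i : ℕ, 1 ≤ i → I ^ i = symbolicPower I i := by
  classical
  have hI' : I = Ideal.span (Set.range fun j => MvPolynomial.monomial (edgeExp (E j)) (1 : K)) := by
    rw [hI]; simp only [edge_monomial]
  have hmemI : ∀ j, MvPolynomial.monomial (edgeExp (E j)) (1 : K) ∈ I := fun j => by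
    rw [hI']; exact Ideal.subset_span ⟨j, rfl⟩
  constructor
  · intro h k _
    have hP := aux_mfmc_comb E hE.1 h
    apply le_antisymm
    · exact le_iInf₂ fun p hp => Ideal.pow_right_mono hp.1.2 k
    · intro f hf
      rw [MvPolynomial.as_sum f]
      refine Ideal.sum_mem _ fun m hm => ?_
      obtain ⟨b, hb1, hb2⟩ := hP m k (fun C hC => by
        have := aux_prime (K := K) (C : Set (Fin n))
        have hle : I ≤ Ideal.span (MvPolynomial.X '' (C : Set (Fin n))) := by
          rw [hI, Ideal.span_le]
          rintro _ ⟨j, rfl⟩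
          obtain ⟨i, hi, hij⟩ := hC j
          exact Ideal.mem_of_dvd _ (Finset.dvd_prod_of_mem _ hij)
            (Ideal.subset_span ⟨i, hi, rfl⟩)
        obtain ⟨p, hp, hpC⟩ := Ideal.exists_minimalPrimes_le hle
        have hfp : f ∈ p ^ k := (Ideal.mem_iInf.1 (Ideal.mem_iInf.1 hf p)) hp
        have hfC := Ideal.pow_right_mono hpC k hfp
        have hr : (MvPolynomial.X '' (C : Set (Fin n)) : Set (MvPolynomial (Fin n) K)) =
            Set.range fun c : C => MvPolynomial.monomial (Finsupp.single (c : Fin n) 1) (1 : K) := by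
          ext g
          simp [MvPolynomial.X]
        rw [hr] at hfC
        obtain ⟨b, hb, hbm⟩ := aux_mem_pow _ k hfC m hm
        rw [← hb, ← Finset.sum_coe_sort C]
        refine Finset.sum_le_sum fun c _ => ?_
        have h1 := hbm c
        refine le_trans ?_ h1
        simp [Finsupp.finsetSum_apply, Finsupp.single_apply, Subtype.coe_inj])
      exact aux_mem_pow_of _ k m _ I hmemI b hb1 ((edgeExp_le E b m).2 hb2)
  · intro h
    apply aux_comb_mfmc E hE.1
    intro α k hk
    rcases Nat.eq_zero_or_pos k with rfl | hkpos
    · exact ⟨0, by simp, by simp⟩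
    let m : Fin n →₀ ℕ := Finsupp.equivFunOnFinite.symm α
    have hm : MvPolynomial.monomial m (1 : K) ∈ I ^ k := by
      rw [h k hkpos]
      refine Ideal.mem_iInf.2 fun p => Ideal.mem_iInf.2 fun hp => ?_
      have hpp : p.IsPrime := hp.1.1
      let C : Finset (Fin n) := Finset.univ.filter fun i => (MvPolynomial.X i : MvPolynomial (Fin n) K) ∈ p
      have hC := hk C (fun j => by
        have h1 : (∏ i ∈ E j, MvPolynomial.X i : MvPolynomial (Fin n) K) ∈ p := by
          rw [edge_monomial]; exact hp.1.2 (hmemI j)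
        obtain ⟨i, hi, hip⟩ := (Ideal.IsPrime.prod_mem_iff).1 h1
        exact ⟨i, by simpa [C] using hip, hi⟩)
      refine aux_mem_pow_of (fun c : C => Finsupp.single (c : Fin n) 1) k m 1 p
        (fun c => (Finset.mem_filter.1 c.2).2) (fun c => α c) ?_ ?_
      · rw [Finset.sum_coe_sort C]; exact hC
      · intro i
        rw [Finset.sum_coe_sort C (fun c => α c • Finsupp.single c 1)]
        simp only [Finsupp.finsetSum_apply, Finsupp.smul_apply, Finsupp.single_apply, smul_eq_mul,
          mul_ite, mul_one, mul_zero, Finset.sum_ite_eq', m]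
        split_ifs <;> simp
    rw [hI'] at hm
    obtain ⟨b, hb, hbm⟩ := aux_mem_pow _ k hm m (by simp [MvPolynomial.mem_support_iff])
    exact ⟨b, hb.ge, (edgeExp_le E b m).1 hbm⟩
end
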